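/- arXiv:1302.3156 — 2 statements merged into one kernel-verified Lean document; each statement's English description precedes it below -/
import Mathlib

section
/- Let n ≥ 3 and let F = (α+β)²/α be a square metric on a connected open set U ⊆ ℝⁿ (with 0 < b² < 1 on U). Suppose there exist smooth functions τ(x) and λ(x) on U such that: (E1) b_{i|j} = τ{(1+2b²)a_{ij} − 3b_ib_j}; (E2) R̄ⁱ_k = λ(α²δⁱ_k − yⁱȳ_k) + 2η(β²δⁱ_k + α²bⁱb_k − β bⁱȳ_k − β b_kyⁱ); and (E3) ∂τ/∂xⁱ = u·b_i, where η := λ + 4(2+b²)τ² and u := −(7+4b²)τ² − λ. Then F is of scalar flag curvature, and the scalar flag curvature is K = (α/F²)·{[λ + τ²(5+4b²)]α + (η − 3τ²)β}. -/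
open scoped BigOperators

noncomputable section

abbrev Vec (n : ℕ) := Fin n → ℝ

/-- Partial derivative of a function on `ℝⁿ` in the `k`-th coordinate direction. -/
def pd {n : ℕ} (f : Vec n → ℝ) (k : Fin n) (x : Vec n) : ℝ :=
  fderiv ℝ f x (Pi.single k 1)

/-- Partial derivative in the base (`x`) variable of a function of `(x, y)`. -/
def pdx {n : ℕ} (f : Vec n → Vec n → ℝ) (k : Fin n) (x y : Vec n) : ℝ :=
  fderiv ℝ (fun x' => f x' y) x (Pi.single k 1)

/-- Partial derivative in the fiber (`y`) variable of a function of `(x, y)`. -/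
def pdy {n : ℕ} (f : Vec n → Vec n → ℝ) (k : Fin n) (x y : Vec n) : ℝ :=
  fderiv ℝ (fun y' => f x y') y (Pi.single k 1)

/-- The fundamental tensor `g_{ij} = ½ ∂²(F²)/∂yⁱ∂yʲ` of a Finsler metric `F`. -/
def fundTensor {n : ℕ} (F : Vec n → Vec n → ℝ) (x y : Vec n) : Matrix (Fin n) (Fin n) ℝ :=
  Matrix.of fun i j => (1/2) * pdy (fun x y => pdy (fun x y => (F x y)^2) j x y) i x y

/-- The geodesic coefficients `Gⁱ = ¼ g^{il}(yᵏ ∂²(F²)/∂xᵏ∂yˡ − ∂(F²)/∂xˡ)`. -/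
def geoCoeff {n : ℕ} (F : Vec n → Vec n → ℝ) (i : Fin n) (x y : Vec n) : ℝ :=
  (1/4) * ∑ l, (fundTensor F x y)⁻¹ i l *
    ((∑ k, y k * pdx (fun x y => pdy (fun x y => (F x y)^2) l x y) k x y)
      - pdx (fun x y => (F x y)^2) l x y)

/-- Riemann curvature `Rⁱ_k` associated to a spray `G`. -/
def curvOfSpray {n : ℕ} (G : Fin n → Vec n → Vec n → ℝ) (i k : Fin n) (x y : Vec n) : ℝ :=
  2 * pdx (G i) k x y
  - ∑ j, y j * pdx (fun x y => pdy (G i) k x y) j x y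
  + 2 * ∑ j, G j x y * pdy (fun x y => pdy (G i) k x y) j x y
  - ∑ j, pdy (G i) j x y * pdy (G j) k x y

/-- Christoffel symbols `Γᵏ_{ij}` of a Riemannian metric field. -/
def christoffel {n : ℕ} (g : Vec n → Matrix (Fin n) (Fin n) ℝ) (k i j : Fin n) (x : Vec n) : ℝ :=
  (1/2) * ∑ l, (g x)⁻¹ k l *
    (pd (fun x => g x l i) j x + pd (fun x => g x l j) i x - pd (fun x => g x i j) l x)

/-- The geodesic spray `Gⁱ_α = ½ Γⁱ_{jk} yʲ yᵏ` of a Riemannian metric. -/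
def sprayOf {n : ℕ} (g : Vec n → Matrix (Fin n) (Fin n) ℝ) (i : Fin n) (x y : Vec n) : ℝ :=
  (1/2) * ∑ j, ∑ k, christoffel g i j k x * y j * y k

/-- Covariant derivative `b_{i|j}` of a 1-form w.r.t. a Riemannian metric. -/
def covDeriv {n : ℕ} (g : Vec n → Matrix (Fin n) (Fin n) ℝ) (b : Vec n → Vec n)
    (i j : Fin n) (x : Vec n) : ℝ :=
  pd (fun x => b x i) j x - ∑ k, b x k * christoffel g k i j x

/-- `b² = a^{ij} b_i b_j`. -/
def bsq {n : ℕ} (a : Vec n → Matrix (Fin n) (Fin n) ℝ) (b : Vec n → Vec n) (x : Vec n) : ℝ :=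
  ∑ i, ∑ j, (a x)⁻¹ i j * b x i * b x j

/-- `α(x,y) = √(a_{ij}(x) yⁱ yʲ)`. -/
def alphaOf {n : ℕ} (a : Vec n → Matrix (Fin n) (Fin n) ℝ) (x y : Vec n) : ℝ :=
  Real.sqrt (∑ i, ∑ j, a x i j * y i * y j)

/-- `β(x,y) = b_i(x) yⁱ`. -/
def betaOf {n : ℕ} (b : Vec n → Vec n) (x y : Vec n) : ℝ := ∑ i, b x i * y i

/-- The square metric `F = (α+β)²/α`. -/
def sqMetric {n : ℕ} (a : Vec n → Matrix (Fin n) (Fin n) ℝ) (b : Vec n → Vec n)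
    (x y : Vec n) : ℝ :=
  (alphaOf a x y + betaOf b x y)^2 / alphaOf a x y

/-- `F` is of scalar flag curvature on `U`. -/
def IsScalarFlag {n : ℕ} (U : Set (Vec n)) (F : Vec n → Vec n → ℝ) : Prop :=
  ∃ K : Vec n → Vec n → ℝ, ∀ x ∈ U, ∀ y : Vec n, y ≠ 0 → ∀ i k : Fin n,
    curvOfSpray (geoCoeff F) i k x y =
      K x y * ((F x y)^2 * (if i = k then (1:ℝ) else 0)
        - y i * ∑ j, fundTensor F x y k j * y j)

/-- Conditions (E1)–(E3). -/
def E123 {n : ℕ} (U : Set (Vec n)) (a : Vec n → Matrix (Fin n) (Fin n) ℝ)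
    (b : Vec n → Vec n) (τ lam : Vec n → ℝ) : Prop :=
  (∀ x ∈ U, ∀ i j : Fin n, covDeriv a b i j x =
      τ x * ((1 + 2 * bsq a b x) * a x i j - 3 * b x i * b x j)) ∧
  (∀ x ∈ U, ∀ y : Vec n, ∀ i k : Fin n,
      curvOfSpray (sprayOf a) i k x y =
        lam x * ((alphaOf a x y)^2 * (if i = k then (1:ℝ) else 0)
            - y i * (∑ j, a x k j * y j))
        + 2 * (lam x + 4 * (2 + bsq a b x) * (τ x)^2) *
          ((betaOf b x y)^2 * (if i = k then (1:ℝ) else 0)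
            + (alphaOf a x y)^2 * (∑ j, (a x)⁻¹ i j * b x j) * b x k
            - betaOf b x y * (∑ j, (a x)⁻¹ i j * b x j) * (∑ j, a x k j * y j)
            - betaOf b x y * b x k * y i)) ∧
  (∀ x ∈ U, ∀ i : Fin n, pd τ i x =
      (-(7 + 4 * bsq a b x) * (τ x)^2 - lam x) * b x i)

open Filter Topology
open scoped Matrix

/-- `f` is differentiable at `x` with partial derivatives given by `f'` there. -/
def HasPD {n : ℕ} (f : Vec n → ℝ) (f' : Fin n → ℝ) (x : Vec n) : Prop :=
  DifferentiableAt ℝ f x ∧ ∀ k, pd f k x = f' k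

namespace HasPD

variable {n : ℕ} {f g : Vec n → ℝ} {f' g' : Fin n → ℝ} {x : Vec n}

theorem of_hasFDerivAt {L : Vec n →L[ℝ] ℝ} (h : HasFDerivAt f L x)
    (hL : ∀ k, L (Pi.single k 1) = f' k) : HasPD f f' x :=
  ⟨h.differentiableAt, fun k => by rw [pd, h.fderiv, hL]⟩

theorem congr (h : HasPD f f' x) (hf : ∀ k, f' k = g' k) : HasPD f g' x :=
  ⟨h.1, fun k => (h.2 k).trans (hf k)⟩

theorem congr_of_eventuallyEq (h : HasPD f f' x) (hfg : g =ᶠ[𝓝 x] f) : HasPD g f' x :=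
  ⟨hfg.differentiableAt_iff.2 h.1, fun k => by rw [pd, hfg.fderiv_eq]; exact h.2 k⟩

theorem of_differentiableAt (h : DifferentiableAt ℝ f x) : HasPD f (fun k => pd f k x) x :=
  ⟨h, fun _ => rfl⟩

theorem const (c : ℝ) : HasPD (fun _ => c) (fun _ => 0) x :=
  of_hasFDerivAt (hasFDerivAt_const c x) fun _ => rfl

theorem coord (i : Fin n) : HasPD (fun x : Vec n => x i) (fun k => if i = k then 1 else 0) x :=
  of_hasFDerivAt (hasFDerivAt_apply i x) fun k => by
    simp [Pi.single_apply]

theorem add (hf : HasPD f f' x) (hg : HasPD g g' x) :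
    HasPD (fun x => f x + g x) (fun k => f' k + g' k) x :=
  of_hasFDerivAt (hf.1.hasFDerivAt.add hg.1.hasFDerivAt) fun k => by
    rw [← hf.2 k, ← hg.2 k]; rfl

theorem sub (hf : HasPD f f' x) (hg : HasPD g g' x) :
    HasPD (fun x => f x - g x) (fun k => f' k - g' k) x :=
  of_hasFDerivAt (hf.1.hasFDerivAt.sub hg.1.hasFDerivAt) fun k => by
    rw [← hf.2 k, ← hg.2 k]; rfl

theorem mul (hf : HasPD f f' x) (hg : HasPD g g' x) :
    HasPD (fun x => f x * g x) (fun k => f' k * g x + f x * g' k) x :=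
  of_hasFDerivAt (hf.1.hasFDerivAt.mul hg.1.hasFDerivAt) fun k => by
    rw [← hf.2 k, ← hg.2 k]
    simp only [add_apply, smul_apply, smul_eq_mul, pd]
    ring

theorem const_mul (c : ℝ) (hf : HasPD f f' x) : HasPD (fun x => c * f x) (fun k => c * f' k) x :=
  ((const c).mul hf).congr fun k => by ring

theorem mul_const (hf : HasPD f f' x) (c : ℝ) : HasPD (fun x => f x * c) (fun k => f' k * c) x :=
  (hf.mul (const c)).congr fun k => by ring

theorem sum {ι : Type*} {s : Finset ι} {f : ι → Vec n → ℝ} {f' : ι → Fin n → ℝ}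
    (h : ∀ i ∈ s, HasPD (f i) (f' i) x) :
    HasPD (fun x => ∑ i ∈ s, f i x) (fun k => ∑ i ∈ s, f' i k) x :=
  of_hasFDerivAt (HasFDerivAt.fun_sum fun i hi => (h i hi).1.hasFDerivAt) fun k => by
    rw [sum_apply]
    exact Finset.sum_congr rfl fun i hi => (h i hi).2 k

theorem comp {φ : ℝ → ℝ} {φ' : ℝ} (hφ : HasDerivAt φ φ' (f x)) (hf : HasPD f f' x) :
    HasPD (fun x => φ (f x)) (fun k => φ' * f' k) x :=
  of_hasFDerivAt (hφ.comp_hasFDerivAt x hf.1.hasFDerivAt) fun k => by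
    rw [← hf.2 k]; rfl

theorem pow (hf : HasPD f f' x) (m : ℕ) :
    HasPD (fun x => f x ^ m) (fun k => m * f x ^ (m - 1) * f' k) x :=
  comp (hasDerivAt_pow m (f x)) hf

theorem inv (hf : HasPD f f' x) (h0 : f x ≠ 0) :
    HasPD (fun x => (f x)⁻¹) (fun k => -(f x ^ 2)⁻¹ * f' k) x :=
  comp (hasDerivAt_inv h0) hf

theorem div (hf : HasPD f f' x) (hg : HasPD g g' x) (h0 : g x ≠ 0) :
    HasPD (fun x => f x / g x) (fun k => f' k / g x - f x * g' k / g x ^ 2) x := by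
  simp only [div_eq_mul_inv]
  exact (hf.mul (hg.inv h0)).congr fun k => by ring

theorem sqrt (hf : HasPD f f' x) (h0 : f x ≠ 0) :
    HasPD (fun x => √(f x)) (fun k => 1 / (2 * √(f x)) * f' k) x :=
  comp (Real.hasDerivAt_sqrt h0) hf

end HasPD

/-- `a` is a smooth Riemannian metric on the open set `U`. -/
structure IsMetricOn {n : ℕ} (U : Set (Vec n)) (a : Vec n → Matrix (Fin n) (Fin n) ℝ) : Prop where
  isOpen : IsOpen U
  contDiffOn : ∀ i j, ContDiffOn ℝ (⊤ : ℕ∞) (fun x => a x i j) U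
  symm : ∀ x ∈ U, (a x).IsSymm
  posDef : ∀ x ∈ U, (a x).PosDef

theorem differentiableAt_det {n : ℕ} {M : Vec n → Matrix (Fin n) (Fin n) ℝ} {x : Vec n}
    (h : ∀ i j, DifferentiableAt ℝ (fun x => M x i j) x) :
    DifferentiableAt ℝ (fun x => (M x).det) x := by
  simp only [Matrix.det_apply']
  fun_prop

theorem differentiableAt_matrix_inv {n : ℕ} {M : Vec n → Matrix (Fin n) (Fin n) ℝ} {x : Vec n}
    (h : ∀ i j, DifferentiableAt ℝ (fun x => M x i j) x) (h0 : (M x).det ≠ 0) (i j : Fin n) :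
    DifferentiableAt ℝ (fun x => (M x)⁻¹ i j) x := by
  simp only [Matrix.inv_def, Matrix.smul_apply, Ring.inverse_eq_inv', smul_eq_mul,
    Matrix.adjugate_apply]
  refine ((differentiableAt_det h).inv h0).mul (differentiableAt_det fun k l => ?_)
  simp only [Matrix.updateRow_apply]
  split_ifs
  · fun_prop
  · exact h k l

namespace IsMetricOn

variable {n : ℕ} {U : Set (Vec n)} {a : Vec n → Matrix (Fin n) (Fin n) ℝ} {x : Vec n}

theorem contDiffAt (h : IsMetricOn U a) (hx : x ∈ U) (i j : Fin n) :
    ContDiffAt ℝ (⊤ : ℕ∞) (fun x => a x i j) x :=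
  (h.contDiffOn i j).contDiffAt (h.isOpen.mem_nhds hx)

theorem differentiableAt (h : IsMetricOn U a) (hx : x ∈ U) (i j : Fin n) :
    DifferentiableAt ℝ (fun x => a x i j) x :=
  (h.contDiffAt hx i j).differentiableAt (by simp)

theorem symm_apply (h : IsMetricOn U a) (hx : x ∈ U) (i j : Fin n) : a x i j = a x j i :=
  (h.symm x hx).apply j i

theorem det_ne_zero (h : IsMetricOn U a) (hx : x ∈ U) : (a x).det ≠ 0 :=
  (h.posDef x hx).det_pos.ne'

theorem sum_inv_mul (h : IsMetricOn U a) (hx : x ∈ U) (i j : Fin n) :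
    ∑ l, (a x)⁻¹ i l * a x l j = if i = j then 1 else 0 := by
  rw [← Matrix.mul_apply, Matrix.nonsing_inv_mul _ (h.det_ne_zero hx).isUnit, Matrix.one_apply]

theorem mulVec_inv_mulVec (h : IsMetricOn U a) (hx : x ∈ U) (v : Vec n) (i : Fin n) :
    (a x *ᵥ ((a x)⁻¹ *ᵥ v)) i = v i := by
  rw [Matrix.mulVec_mulVec, Matrix.mul_nonsing_inv _ (h.det_ne_zero hx).isUnit, Matrix.one_mulVec]

theorem inv_mulVec_mulVec (h : IsMetricOn U a) (hx : x ∈ U) (v : Vec n) (i : Fin n) :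
    ((a x)⁻¹ *ᵥ (a x *ᵥ v)) i = v i := by
  rw [Matrix.mulVec_mulVec, Matrix.nonsing_inv_mul _ (h.det_ne_zero hx).isUnit, Matrix.one_mulVec]

theorem sum_mul_mulVec (h : IsMetricOn U a) (hx : x ∈ U) (v w : Vec n) :
    ∑ i, v i * (a x *ᵥ w) i = ∑ i, (a x *ᵥ v) i * w i := by
  simp only [Matrix.mulVec, dotProduct, Finset.mul_sum, Finset.sum_mul]
  rw [Finset.sum_comm]
  refine Finset.sum_congr rfl fun i _ => Finset.sum_congr rfl fun j _ => ?_
  rw [h.symm_apply hx]; ring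

theorem pd_symm (h : IsMetricOn U a) (hx : x ∈ U) (i j k : Fin n) :
    pd (fun x => a x i j) k x = pd (fun x => a x j i) k x := by
  have : (fun x => a x i j) =ᶠ[𝓝 x] fun x => a x j i :=
    (h.isOpen.eventually_mem hx).mono fun z hz => h.symm_apply hz i j
  rw [pd, this.fderiv_eq, pd]

theorem christoffel_symm (h : IsMetricOn U a) (hx : x ∈ U) (k i j : Fin n) :
    christoffel a k i j x = christoffel a k j i x := by
  simp only [christoffel]
  congr 1
  refine Finset.sum_congr rfl fun l _ => ?_
  rw [h.pd_symm hx i j]; ring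

theorem lower_christoffel (h : IsMetricOn U a) (hx : x ∈ U) (m i j : Fin n) :
    ∑ l, a x m l * christoffel a l i j x =
      (1 / 2) * (pd (fun x => a x m i) j x + pd (fun x => a x m j) i x
        - pd (fun x => a x i j) m x) := by
  have := h.mulVec_inv_mulVec hx (fun m => pd (fun x => a x m i) j x + pd (fun x => a x m j) i x
        - pd (fun x => a x i j) m x) m
  rw [← this]
  simp only [Matrix.mulVec, dotProduct, christoffel, Finset.mul_sum]
  exact Finset.sum_congr rfl fun l _ => Finset.sum_congr rfl fun _ _ => by ring

theorem hasPD (h : IsMetricOn U a) (hx : x ∈ U) (i j : Fin n) :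
    HasPD (fun x => a x i j) (fun k => ∑ l, a x i l * christoffel a l j k x
      + ∑ l, a x j l * christoffel a l i k x) x :=
  ⟨h.differentiableAt hx i j, fun k => by
    beta_reduce
    rw [h.lower_christoffel hx, h.lower_christoffel hx, h.pd_symm hx j i k, h.pd_symm hx j k i]
    ring⟩

theorem differentiableAt_christoffel (h : IsMetricOn U a) (hx : x ∈ U) (k i j : Fin n) :
    DifferentiableAt ℝ (christoffel a k i j) x := by
  have hpd : ∀ i j k, DifferentiableAt ℝ (fun x => pd (fun x => a x i j) k x) x := fun i j k => by
    have h1 : DifferentiableAt ℝ (fderiv ℝ fun x => a x i j) x :=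
      ((h.contDiffAt hx i j).fderiv_right (m := 1) (WithTop.coe_le_coe.2 le_top)).differentiableAt
        (by simp)
    exact h1.clm_apply (differentiableAt_const _)
  have hinv := fun l => differentiableAt_matrix_inv (h.differentiableAt hx) (h.det_ne_zero hx) k l
  unfold christoffel
  exact (DifferentiableAt.fun_sum fun l _ =>
    (hinv l).mul (((hpd _ _ _).add (hpd _ _ _)).sub (hpd _ _ _))).const_mul _

end IsMetricOn

theorem sum_mul_lin₂ {n : ℕ} (u v w : Fin n → ℝ) (c d : ℝ) :
    ∑ i, u i * (c * v i + d * w i) = c * ∑ i, u i * v i + d * ∑ i, u i * w i := by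
  simp only [Finset.mul_sum, ← Finset.sum_add_distrib]
  exact Finset.sum_congr rfl fun _ _ => by ring

/-- The nonlinear connection `Nⁱ_k = Γⁱ_{kj} yʲ` of a Riemannian metric. -/
def conn {n : ℕ} (a : Vec n → Matrix (Fin n) (Fin n) ℝ) (x y : Vec n) (i k : Fin n) : ℝ :=
  ∑ j, christoffel a i k j x * y j

theorem sum_mul_conn {n : ℕ} (a : Vec n → Matrix (Fin n) (Fin n) ℝ) (x y : Vec n) (i : Fin n) :
    ∑ k, y k * conn a x y i k = 2 * sprayOf a i x y := by
  simp only [conn, sprayOf, Finset.mul_sum]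
  exact Finset.sum_congr rfl fun _ _ => Finset.sum_congr rfl fun _ _ => by ring

theorem sum_mul_sum_conn {n : ℕ} (a : Vec n → Matrix (Fin n) (Fin n) ℝ) (x y : Vec n)
    (v : Fin n → ℝ) :
    ∑ k, y k * ∑ m, v m * conn a x y m k = 2 * ∑ m, v m * sprayOf a m x y := by
  have : ∀ m, v m * sprayOf a m x y = 1 / 2 * (v m * ∑ k, y k * conn a x y m k) := fun m => by
    rw [sum_mul_conn]; ring
  simp only [this, Finset.mul_sum]
  rw [Finset.sum_comm]
  exact Finset.sum_congr rfl fun _ _ => Finset.sum_congr rfl fun _ _ => by ring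

theorem sum_mul_sum_christoffel {n : ℕ} (a : Vec n → Matrix (Fin n) (Fin n) ℝ) (x y : Vec n)
    (v : Fin n → ℝ) (l : Fin n) :
    ∑ k, y k * ∑ m, v m * christoffel a m l k x = ∑ m, v m * conn a x y m l := by
  simp only [conn, Finset.mul_sum]
  rw [Finset.sum_comm]
  exact Finset.sum_congr rfl fun _ _ => Finset.sum_congr rfl fun _ _ => by ring

theorem alphaOf_eq {n : ℕ} (a : Vec n → Matrix (Fin n) (Fin n) ℝ) (x y : Vec n) :
    alphaOf a x y = √(∑ i, y i * (a x *ᵥ y) i) := by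
  simp only [alphaOf, Matrix.mulVec, dotProduct, Finset.mul_sum]
  congr 1
  exact Finset.sum_congr rfl fun _ _ => Finset.sum_congr rfl fun _ _ => by ring

namespace IsMetricOn

variable {n : ℕ} {U : Set (Vec n)} {a : Vec n → Matrix (Fin n) (Fin n) ℝ} {x : Vec n}

theorem quad_pos (h : IsMetricOn U a) (hx : x ∈ U) {y : Vec n} (hy : y ≠ 0) :
    0 < ∑ i, y i * (a x *ᵥ y) i := by
  simpa [dotProduct] using (h.posDef x hx).dotProduct_mulVec_pos hy

theorem quad_nonneg (h : IsMetricOn U a) (hx : x ∈ U) (y : Vec n) :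
    0 ≤ ∑ i, y i * (a x *ᵥ y) i := by
  rcases eq_or_ne y 0 with rfl | hy
  · simp
  · exact (h.quad_pos hx hy).le

theorem alpha_pos (h : IsMetricOn U a) (hx : x ∈ U) {y : Vec n} (hy : y ≠ 0) :
    0 < alphaOf a x y := by
  rw [alphaOf_eq]
  exact Real.sqrt_pos.2 (h.quad_pos hx hy)

theorem sum_mul_mulVec_self (h : IsMetricOn U a) (hx : x ∈ U) (y : Vec n) :
    ∑ i, y i * (a x *ᵥ y) i = alphaOf a x y ^ 2 := by
  rw [alphaOf_eq, Real.sq_sqrt (h.quad_nonneg hx y)]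

theorem hasPD_mulVec (h : IsMetricOn U a) (hx : x ∈ U) (y : Vec n) (l : Fin n) :
    HasPD (fun x => (a x *ᵥ y) l) (fun k => ∑ m, a x l m * conn a x y m k
      + ∑ m, (a x *ᵥ y) m * christoffel a m l k x) x := by
  change HasPD (fun x => ∑ j, a x l j * y j) _ x
  refine (HasPD.sum fun j _ => (h.hasPD hx l j).mul_const (y j)).congr fun k => ?_
  simp only [add_mul, Finset.sum_add_distrib, conn, Matrix.mulVec, dotProduct, Finset.mul_sum,
    Finset.sum_mul]
  congr 1 <;> rw [Finset.sum_comm] <;>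
    refine Finset.sum_congr rfl fun i _ => Finset.sum_congr rfl fun j _ => ?_
  · rw [h.christoffel_symm hx i j k]; ring
  · rw [h.symm_apply hx]; ring

theorem hasPD_quad (h : IsMetricOn U a) (hx : x ∈ U) (y : Vec n) :
    HasPD (fun x => ∑ i, y i * (a x *ᵥ y) i)
      (fun k => 2 * ∑ m, (a x *ᵥ y) m * conn a x y m k) x := by
  refine (HasPD.sum fun i _ => (h.hasPD_mulVec hx y i).const_mul (y i)).congr fun k => ?_
  simp only [mul_add, Finset.sum_add_distrib]
  have h1 := h.sum_mul_mulVec hx y (fun m => conn a x y m k)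
  have h2 : ∑ i, y i * ∑ m, (a x *ᵥ y) m * christoffel a m i k x
      = ∑ m, (a x *ᵥ y) m * conn a x y m k := by
    rw [← sum_mul_sum_christoffel]
    simp only [h.christoffel_symm hx _ _ k]
  simp only [Matrix.mulVec, dotProduct] at h1 h2 ⊢
  rw [h1, h2]; ring

theorem hasPD_alpha (h : IsMetricOn U a) (hx : x ∈ U) {y : Vec n} (hy : y ≠ 0) :
    HasPD (fun x => alphaOf a x y)
      (fun k => (∑ m, (a x *ᵥ y) m * conn a x y m k) / alphaOf a x y) x := by
  simp only [alphaOf_eq]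
  refine ((h.hasPD_quad hx y).sqrt (h.quad_pos hx hy).ne').congr fun k => ?_
  field_simp

theorem hasPD_mulVec_fiber (A : Matrix (Fin n) (Fin n) ℝ) (y : Vec n) (l : Fin n) :
    HasPD (fun y => (A *ᵥ y) l) (fun k => A l k) y := by
  change HasPD (fun y => ∑ j, A l j * y j) _ y
  exact (HasPD.sum fun j _ => (HasPD.coord j).const_mul (A l j)).congr fun k => by simp

theorem hasPD_alpha_fiber (h : IsMetricOn U a) (hx : x ∈ U) {y : Vec n} (hy : y ≠ 0) :
    HasPD (fun y => alphaOf a x y) (fun k => (a x *ᵥ y) k / alphaOf a x y) y := by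
  simp only [alphaOf_eq]
  refine ((HasPD.sum fun i _ => (HasPD.coord i).mul (hasPD_mulVec_fiber (a x) y i)).sqrt
    (h.quad_pos hx hy).ne').congr fun k => ?_
  have : ∑ i, y i * a x i k = (a x *ᵥ y) k :=
    Finset.sum_congr rfl fun i _ => by rw [h.symm_apply hx]; ring
  simp only [ite_mul, one_mul, zero_mul, Finset.sum_add_distrib, Finset.sum_ite_eq',
    Finset.mem_univ, if_true, this]
  field_simp
  ring

theorem differentiableAt_conn (h : IsMetricOn U a) (hx : x ∈ U) (y : Vec n) (i k : Fin n) :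
    DifferentiableAt ℝ (fun x => conn a x y i k) x :=
  DifferentiableAt.fun_sum fun j _ => (h.differentiableAt_christoffel hx i k j).mul_const _

theorem hasPD_spray_fiber (h : IsMetricOn U a) (hx : x ∈ U) (y : Vec n) (i : Fin n) :
    HasPD (fun y => sprayOf a i x y) (fun k => conn a x y i k) y := by
  refine ((HasPD.sum fun j _ => HasPD.sum fun k _ => ((HasPD.coord j).const_mul
    (christoffel a i j k x)).mul (HasPD.coord k)).const_mul _).congr fun k => ?_
  simp only [Finset.sum_add_distrib, mul_ite, mul_one, mul_zero, ite_mul, zero_mul,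
    Finset.sum_ite_eq', Finset.mem_univ, if_true, conn]
  rw [Finset.sum_comm]
  simp only [Finset.sum_ite_eq', Finset.mem_univ, if_true, h.christoffel_symm hx i _ k]
  ring

theorem hasPD_conn_fiber (y : Vec n) (i k : Fin n) :
    HasPD (fun y => conn a x y i k) (fun j => christoffel a i k j x) y :=
  (HasPD.sum fun j _ => (HasPD.coord j).const_mul (christoffel a i k j x)).congr fun k => by simp

theorem differentiableAt_spray (h : IsMetricOn U a) (hx : x ∈ U) (y : Vec n) (i : Fin n) :
    DifferentiableAt ℝ (fun x => sprayOf a i x y) x :=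
  (DifferentiableAt.fun_sum fun j _ => DifferentiableAt.fun_sum fun k _ =>
    ((h.differentiableAt_christoffel hx i j k).mul_const _).mul_const _).const_mul _

end IsMetricOn

/-- A smooth Riemannian metric and a one-form of norm in `(0, 1)` satisfying the structure
equations `E123`. -/
structure IsSquareSolution {n : ℕ} (U : Set (Vec n)) (a : Vec n → Matrix (Fin n) (Fin n) ℝ)
    (b : Vec n → Vec n) (τ lam : Vec n → ℝ) : Prop extends IsMetricOn U a where
  differentiableAt_form : ∀ x ∈ U, ∀ i, DifferentiableAt ℝ (fun x => b x i) x
  differentiableAt_tau : ∀ x ∈ U, DifferentiableAt ℝ τ x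
  bsq_pos : ∀ x ∈ U, 0 < bsq a b x
  bsq_lt_one : ∀ x ∈ U, bsq a b x < 1
  eqns : E123 U a b τ lam

/-- `∂(F²)/∂α = α p` for the square metric. -/
def coeffP (α β : ℝ) : ℝ := 2 * (α + β) ^ 3 * (α - β) / α ^ 4

/-- `∂(F²)/∂β` for the square metric. -/
def coeffQ (α β : ℝ) : ℝ := 4 * (α + β) ^ 3 / α ^ 2

/-- `α⁻¹ ∂p/∂α`. -/
def coeffS (α β : ℝ) : ℝ :=
  2 * (3 * (α + β) ^ 2 * (α - β) * α + (α + β) ^ 3 * α - 4 * (α + β) ^ 3 * (α - β)) / α ^ 6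

/-- `∂p/∂β = α⁻¹ ∂q/∂α`. -/
def coeffT (α β : ℝ) : ℝ := 4 * (α + β) ^ 2 * (α - 2 * β) / α ^ 4

/-- `∂q/∂β`. -/
def coeffR (α β : ℝ) : ℝ := 12 * (α + β) ^ 2 / α ^ 2

namespace HasPD

variable {n : ℕ} {f g : Vec n → ℝ} {f' g' : Fin n → ℝ} {x : Vec n}

theorem sqMetric_sq (hf : HasPD f f' x) (hg : HasPD g g' x) (h0 : f x ≠ 0) :
    HasPD (fun x => ((f x + g x) ^ 2 / f x) ^ 2)
      (fun k => coeffP (f x) (g x) * f x * f' k + coeffQ (f x) (g x) * g' k) x :=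
  ((((hf.add hg).pow 2).div hf h0).pow 2).congr fun k => by
    simp only [coeffP, coeffQ, Nat.add_one_sub_one, pow_one, Nat.cast_ofNat]
    field_simp
    ring

theorem coeffP (hf : HasPD f f' x) (hg : HasPD g g' x) (h0 : f x ≠ 0) :
    HasPD (fun x => coeffP (f x) (g x))
      (fun k => coeffS (f x) (g x) * f x * f' k + coeffT (f x) (g x) * g' k) x :=
  (((((hf.add hg).pow 3).const_mul 2).mul (hf.sub hg)).div (hf.pow 4) (pow_ne_zero 4 h0)).congr
    fun k => by
    simp only [coeffS, coeffT, Nat.add_one_sub_one, Nat.cast_ofNat]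
    field_simp
    ring

theorem coeffQ (hf : HasPD f f' x) (hg : HasPD g g' x) (h0 : f x ≠ 0) :
    HasPD (fun x => coeffQ (f x) (g x))
      (fun k => coeffT (f x) (g x) * f x * f' k + coeffR (f x) (g x) * g' k) x :=
  ((((hf.add hg).pow 3).const_mul 4).div (hf.pow 2) (pow_ne_zero 2 h0)).congr
    fun k => by
    simp only [coeffR, coeffT, Nat.add_one_sub_one, pow_one, Nat.cast_ofNat]
    field_simp
    ring

end HasPD

theorem hasPD_beta_fiber {n : ℕ} (b : Vec n → Vec n) (x y : Vec n) :
    HasPD (fun y => betaOf b x y) (b x) y :=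
  (HasPD.sum fun j _ => (HasPD.coord j).const_mul (b x j)).congr fun k => by simp

/-- The deviation of the spray of the square metric from that of `α`. -/
def sprayDev {n : ℕ} (a : Vec n → Matrix (Fin n) (Fin n) ℝ) (b : Vec n → Vec n) (τ : Vec n → ℝ)
    (i : Fin n) (x y : Vec n) : ℝ :=
  τ x * (alphaOf a x y ^ 2 * ((a x)⁻¹ *ᵥ b x) i + (alphaOf a x y - 2 * betaOf b x y) * y i)

namespace IsSquareSolution

variable {n : ℕ} {U : Set (Vec n)} {a : Vec n → Matrix (Fin n) (Fin n) ℝ} {b : Vec n → Vec n}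
  {τ lam : Vec n → ℝ} {x y : Vec n}

theorem hasPD_form (h : IsSquareSolution U a b τ lam) (hx : x ∈ U) (l : Fin n) :
    HasPD (fun x => b x l) (fun k => τ x * ((1 + 2 * bsq a b x) * a x l k - 3 * b x l * b x k)
      + ∑ m, b x m * christoffel a m l k x) x :=
  ⟨h.differentiableAt_form x hx l, fun k => by
    have := h.eqns.1 x hx l k
    rw [covDeriv] at this
    linarith⟩

theorem hasPD_tau (h : IsSquareSolution U a b τ lam) (hx : x ∈ U) :
    HasPD τ (fun k => (-(7 + 4 * bsq a b x) * (τ x)^2 - lam x) * b x k) x :=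
  ⟨h.differentiableAt_tau x hx, h.eqns.2.2 x hx⟩

theorem hasPD_beta (h : IsSquareSolution U a b τ lam) (hx : x ∈ U) (y : Vec n) :
    HasPD (fun x => betaOf b x y)
      (fun k => τ x * ((1 + 2 * bsq a b x) * (a x *ᵥ y) k - 3 * b x k * betaOf b x y)
        + ∑ m, b x m * conn a x y m k) x := by
  change HasPD (fun x => ∑ i, b x i * y i) _ x
  refine (HasPD.sum fun j _ => (h.hasPD_form hx j).mul_const (y j)).congr fun k => ?_
  have e : (a x *ᵥ y) k = ∑ j, a x k j * y j := rfl
  rw [← sum_mul_sum_christoffel, e, betaOf]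
  simp only [Finset.mul_sum, ← Finset.sum_sub_distrib, ← Finset.sum_add_distrib]
  refine Finset.sum_congr rfl fun j _ => ?_
  rw [← Finset.mul_sum, h.symm_apply hx j k]
  simp only [h.christoffel_symm hx _ j k]
  ring

theorem sum_form_mul_raised (h : IsSquareSolution U a b τ lam) (hx : x ∈ U) (v : Vec n) :
    ∑ i, (a x *ᵥ v) i * ((a x)⁻¹ *ᵥ b x) i = ∑ i, b x i * v i := by
  rw [← h.sum_mul_mulVec hx]
  exact Finset.sum_congr rfl fun i _ => by rw [h.mulVec_inv_mulVec hx]; ring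

theorem bsq_eq (a : Vec n → Matrix (Fin n) (Fin n) ℝ) (b : Vec n → Vec n) (x : Vec n) :
    ∑ i, b x i * ((a x)⁻¹ *ᵥ b x) i = bsq a b x := by
  simp only [Matrix.mulVec, dotProduct, Finset.mul_sum, bsq]
  exact Finset.sum_congr rfl fun i _ => Finset.sum_congr rfl fun j _ => by ring

theorem differentiableAt_raised (h : IsSquareSolution U a b τ lam) (hx : x ∈ U) (i : Fin n) :
    DifferentiableAt ℝ (fun x => ((a x)⁻¹ *ᵥ b x) i) x :=
  DifferentiableAt.fun_sum (u := Finset.univ) fun j _ =>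
    (differentiableAt_matrix_inv (h.differentiableAt hx) (h.det_ne_zero hx) i j).fun_mul
      (h.differentiableAt_form x hx j)

theorem hasPD_raised (h : IsSquareSolution U a b τ lam) (hx : x ∈ U) (i : Fin n) :
    HasPD (fun x => ((a x)⁻¹ *ᵥ b x) i)
      (fun k => τ x * ((1 + 2 * bsq a b x) * (if i = k then 1 else 0)
          - 3 * ((a x)⁻¹ *ᵥ b x) i * b x k)
        - ∑ j, christoffel a i k j x * ((a x)⁻¹ *ᵥ b x) j) x := by
  refine ⟨h.differentiableAt_raised hx i, fun k => ?_⟩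
  have hlow : ∀ l, ∑ j, a x l j * pd (fun x => ((a x)⁻¹ *ᵥ b x) j) k x
      = τ x * ((1 + 2 * bsq a b x) * a x l k - 3 * b x l * b x k)
        - ∑ m, a x l m * ∑ j, christoffel a m k j x * ((a x)⁻¹ *ᵥ b x) j := fun l => by
    have h1 := (HasPD.sum (s := Finset.univ) fun j _ => (h.hasPD hx l j).mul
      (HasPD.of_differentiableAt (h.differentiableAt_raised hx j)))
    have h2 := h1.congr_of_eventuallyEq (g := fun x => b x l)
      ((h.isOpen.eventually_mem hx).mono fun z hz => (h.mulVec_inv_mulVec hz (b z) l).symm)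
    have h3 := (h2.2 k).symm.trans ((h.hasPD_form hx l).2 k)
    simp only [add_mul, Finset.sum_add_distrib] at h3
    have h4 : ∑ j, (∑ m, a x l m * christoffel a m j k x) * ((a x)⁻¹ *ᵥ b x) j
        = ∑ m, a x l m * ∑ j, christoffel a m k j x * ((a x)⁻¹ *ᵥ b x) j := by
      simp only [Finset.sum_mul, Finset.mul_sum]
      rw [Finset.sum_comm]
      refine Finset.sum_congr rfl fun i _ => Finset.sum_congr rfl fun j _ => ?_
      rw [h.christoffel_symm hx i j k]; ring
    have h5 : ∑ j, (∑ m, a x j m * christoffel a m l k x) * ((a x)⁻¹ *ᵥ b x) j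
        = ∑ m, b x m * christoffel a m l k x := by
      rw [← h.sum_form_mul_raised hx]; rfl
    rw [h4, h5] at h3
    linarith
  have hinv := h.inv_mulVec_mulVec hx (fun j => pd (fun x => ((a x)⁻¹ *ᵥ b x) j) k x) i
  have hcol : (a x)⁻¹ *ᵥ (fun l => a x l k) = fun i => if i = k then 1 else 0 :=
    funext fun i => h.sum_inv_mul hx i k
  have hvec : (a x *ᵥ fun j => pd (fun x => ((a x)⁻¹ *ᵥ b x) j) k x)
      = (τ x * (1 + 2 * bsq a b x)) • (fun l => a x l k) - (τ x * 3 * b x k) • b x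
        - a x *ᵥ (fun m => ∑ j, christoffel a m k j x * ((a x)⁻¹ *ᵥ b x) j) := by
    ext l
    refine (hlow l).trans ?_
    simp only [Pi.sub_apply, Pi.smul_apply, smul_eq_mul, Matrix.mulVec, dotProduct]
    ring
  rw [← hinv, hvec, Matrix.mulVec_sub, Matrix.mulVec_sub, Matrix.mulVec_smul, Matrix.mulVec_smul,
    hcol]
  simp only [Pi.sub_apply, Pi.smul_apply, smul_eq_mul, h.inv_mulVec_mulVec hx]
  ring

/-- The Cauchy–Schwarz inequality for `β` with respect to `α`. -/
theorem beta_sq_lt (h : IsSquareSolution U a b τ lam) (hx : x ∈ U) (hy : y ≠ 0) :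
    betaOf b x y ^ 2 < alphaOf a x y ^ 2 := by
  have hb := h.bsq_pos x hx
  have hz := h.quad_nonneg hx (bsq a b x • y - betaOf b x y • ((a x)⁻¹ *ᵥ b x))
  have hq : ∑ i, (bsq a b x • y - betaOf b x y • ((a x)⁻¹ *ᵥ b x)) i *
      (a x *ᵥ (bsq a b x • y - betaOf b x y • ((a x)⁻¹ *ᵥ b x))) i
      = bsq a b x * (bsq a b x * alphaOf a x y ^ 2 - betaOf b x y ^ 2) := by
    have e1 := h.sum_mul_mulVec_self hx y
    have e2 := h.sum_form_mul_raised hx y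
    have e3 := bsq_eq a b x
    have e4 : ∑ i, b x i * y i = betaOf b x y := rfl
    rw [Matrix.mulVec_sub, Matrix.mulVec_smul, Matrix.mulVec_smul]
    have : ∀ i, (bsq a b x • y - betaOf b x y • ((a x)⁻¹ *ᵥ b x)) i *
        (bsq a b x • (a x *ᵥ y) - betaOf b x y • (a x *ᵥ ((a x)⁻¹ *ᵥ b x))) i
        = bsq a b x ^ 2 * (y i * (a x *ᵥ y) i)
          - bsq a b x * betaOf b x y * ((a x *ᵥ y) i * ((a x)⁻¹ *ᵥ b x) i)
          - bsq a b x * betaOf b x y * (b x i * y i)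
          + betaOf b x y ^ 2 * (b x i * ((a x)⁻¹ *ᵥ b x) i) := fun i => by
      simp only [Pi.sub_apply, Pi.smul_apply, smul_eq_mul, h.mulVec_inv_mulVec hx]
      ring
    simp only [this, Finset.sum_add_distrib, Finset.sum_sub_distrib, ← Finset.mul_sum, e1, e2, e3,
      e4]
    ring
  rw [hq] at hz
  have h1 := nonneg_of_mul_nonneg_right hz hb
  have h2 : 0 < alphaOf a x y ^ 2 := pow_pos (h.alpha_pos hx hy) 2
  nlinarith [h.bsq_lt_one x hx]

theorem pdy_sq (h : IsSquareSolution U a b τ lam) (hx : x ∈ U) (hy : y ≠ 0) (l : Fin n) :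
    pdy (fun x y => sqMetric a b x y ^ 2) l x y =
      coeffP (alphaOf a x y) (betaOf b x y) * (a x *ᵥ y) l
        + coeffQ (alphaOf a x y) (betaOf b x y) * b x l := by
  have h0 := (h.alpha_pos hx hy).ne'
  refine (((h.hasPD_alpha_fiber hx hy).sqMetric_sq (hasPD_beta_fiber b x y) h0).2 l).trans ?_
  field_simp

theorem fundTensor_eq (h : IsSquareSolution U a b τ lam) (hx : x ∈ U) (hy : y ≠ 0) (i l : Fin n) :
    fundTensor (sqMetric a b) x y i l = 1 / 2 * (coeffP (alphaOf a x y) (betaOf b x y) * a x i l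
      + coeffS (alphaOf a x y) (betaOf b x y) * (a x *ᵥ y) i * (a x *ᵥ y) l
      + coeffT (alphaOf a x y) (betaOf b x y) * ((a x *ᵥ y) i * b x l + b x i * (a x *ᵥ y) l)
      + coeffR (alphaOf a x y) (betaOf b x y) * b x i * b x l) := by
  have h0 := (h.alpha_pos hx hy).ne'
  have hα := h.hasPD_alpha_fiber hx hy
  have hβ := hasPD_beta_fiber b x y
  have h1 := ((hα.coeffP hβ h0).mul (IsMetricOn.hasPD_mulVec_fiber (a x) y l)).add
    ((hα.coeffQ hβ h0).mul_const (b x l))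
  have h2 := h1.congr_of_eventuallyEq
    (g := fun y => pdy (fun x y => sqMetric a b x y ^ 2) l x y)
    ((isOpen_ne.eventually_mem hy).mono fun z hz => h.pdy_sq hx hz l)
  refine congrArg (1 / 2 * ·) ((h2.2 i).trans ?_)
  beta_reduce
  rw [h.symm_apply hx l i]
  field_simp
  ring

theorem fundTensor_mulVec (h : IsSquareSolution U a b τ lam) (hx : x ∈ U) (hy : y ≠ 0) (w : Vec n)
    (i : Fin n) :
    (fundTensor (sqMetric a b) x y *ᵥ w) i =
      1 / 2 * (coeffP (alphaOf a x y) (betaOf b x y) * (a x *ᵥ w) i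
      + (coeffS (alphaOf a x y) (betaOf b x y) * (a x *ᵥ y) i
        + coeffT (alphaOf a x y) (betaOf b x y) * b x i) * ∑ l, (a x *ᵥ y) l * w l
      + (coeffT (alphaOf a x y) (betaOf b x y) * (a x *ᵥ y) i
        + coeffR (alphaOf a x y) (betaOf b x y) * b x i) * ∑ l, b x l * w l) := by
  have e : (a x *ᵥ w) i = ∑ l, a x i l * w l := rfl
  rw [e]
  change ∑ l, fundTensor (sqMetric a b) x y i l * w l = _
  simp only [Finset.mul_sum, ← Finset.sum_add_distrib]
  refine Finset.sum_congr rfl fun l _ => ?_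
  rw [h.fundTensor_eq hx hy]
  ring

theorem det_fundTensor_ne_zero (h : IsSquareSolution U a b τ lam) (hx : x ∈ U) (hy : y ≠ 0) :
    (fundTensor (sqMetric a b) x y).det ≠ 0 := by
  intro hdet
  obtain ⟨v, hv, hgv⟩ := Matrix.exists_mulVec_eq_zero_iff.2 hdet
  have hα := h.alpha_pos hx hy
  obtain ⟨hβ1, hβ2⟩ := abs_lt.1 (abs_lt_of_sq_lt_sq (h.beta_sq_lt hx hy) hα.le)
  have e0 : ∑ i, v i * (fundTensor (sqMetric a b) x y *ᵥ v) i = 0 := by simp [hgv]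
  set α := alphaOf a x y
  set β := betaOf b x y
  set V := ∑ i, v i * (a x *ᵥ v) i with hV
  set Y := ∑ i, (a x *ᵥ y) i * v i with hY
  set B := ∑ i, b x i * v i with hB
  have e1 : ∑ i, v i * (fundTensor (sqMetric a b) x y *ᵥ v) i
      = 1 / 2 * (coeffP α β * V + coeffS α β * Y ^ 2 + 2 * coeffT α β * Y * B
        + coeffR α β * B ^ 2) := by
    have : ∀ i, v i * (fundTensor (sqMetric a b) x y *ᵥ v) i
        = 1 / 2 * coeffP α β * (v i * (a x *ᵥ v) i)
          + 1 / 2 * (coeffS α β * Y + coeffT α β * B) * ((a x *ᵥ y) i * v i)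
          + 1 / 2 * (coeffT α β * Y + coeffR α β * B) * (b x i * v i) := fun i => by
      rw [h.fundTensor_mulVec hx hy]
      ring
    simp only [this, Finset.sum_add_distrib, ← Finset.mul_sum, ← hV, ← hY, ← hB]
    ring
  have e2 : ∀ i, (α ^ 2 • v - Y • y) i * (a x *ᵥ (α ^ 2 • v - Y • y)) i
      = α ^ 4 * (v i * (a x *ᵥ v) i) - α ^ 2 * Y * ((a x *ᵥ y) i * v i)
        - α ^ 2 * Y * (y i * (a x *ᵥ v) i) + Y ^ 2 * (y i * (a x *ᵥ y) i) := fun i => by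
    rw [Matrix.mulVec_sub, Matrix.mulVec_smul, Matrix.mulVec_smul]
    simp only [Pi.sub_apply, Pi.smul_apply, smul_eq_mul]
    ring
  have e3 : ∑ i, (α ^ 2 • v - Y • y) i * (a x *ᵥ (α ^ 2 • v - Y • y)) i
      = α ^ 2 * (α ^ 2 * V - Y ^ 2) := by
    simp only [e2, Finset.sum_add_distrib, Finset.sum_sub_distrib, ← Finset.mul_sum,
      h.sum_mul_mulVec hx y v, h.sum_mul_mulVec_self hx y, ← hV, ← hY]
    ring
  have hCS : 0 ≤ α ^ 2 * V - Y ^ 2 :=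
    nonneg_of_mul_nonneg_right (e3 ▸ h.quad_nonneg hx _) (pow_pos hα 2)
  have e4 : (Y * (α + β) ^ 2 / α ^ 3 + 2 * (α + β) / α * (B - Y / α ^ 2 * β)) ^ 2
      + 2 * (α + β) ^ 2 / α ^ 2 * (B - Y / α ^ 2 * β) ^ 2
      + (α + β) ^ 3 * (α - β) / α ^ 6 * (α ^ 2 * V - Y ^ 2) = 0 := by
    rw [← e0, e1]
    simp only [coeffP, coeffS, coeffT, coeffR]
    field_simp
    ring
  have hs : 0 < α + β := by linarith
  have hd : 0 < α - β := by linarith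
  have k1 : 0 < 2 * (α + β) ^ 2 / α ^ 2 := by positivity
  have k2 : 0 < (α + β) ^ 3 * (α - β) / α ^ 6 := by positivity
  have p1 := sq_nonneg (Y * (α + β) ^ 2 / α ^ 3 + 2 * (α + β) / α * (B - Y / α ^ 2 * β))
  have p2 := mul_nonneg k1.le (sq_nonneg (B - Y / α ^ 2 * β))
  have p3 := mul_nonneg k2.le hCS
  have z3 : α ^ 2 * V - Y ^ 2 = 0 :=
    (mul_eq_zero.1 (by linarith : (α + β) ^ 3 * (α - β) / α ^ 6 * (α ^ 2 * V - Y ^ 2) = 0)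
      ).resolve_left k2.ne'
  have z2 : B - Y / α ^ 2 * β = 0 := pow_eq_zero_iff two_ne_zero |>.1
    ((mul_eq_zero.1 (by linarith : 2 * (α + β) ^ 2 / α ^ 2 * (B - Y / α ^ 2 * β) ^ 2 = 0)
      ).resolve_left k1.ne')
  have z1 : Y = 0 := by
    have : Y * (α + β) ^ 2 / α ^ 3 + 2 * (α + β) / α * (B - Y / α ^ 2 * β) = 0 :=
      pow_eq_zero_iff two_ne_zero |>.1 (by linarith)
    rw [z2, mul_zero, add_zero] at this
    have hne : (α + β) ^ 2 / α ^ 3 ≠ 0 := by positivity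
    rw [mul_div_assoc] at this
    exact (mul_eq_zero.1 this).resolve_right hne
  refine (h.quad_pos hx (y := α ^ 2 • v - Y • y) ?_).ne' (by rw [e3, z3, mul_zero])
  rw [z1, zero_smul, sub_zero]
  exact smul_ne_zero (pow_ne_zero 2 hα.ne') hv

theorem sum_mul_sprayDev (a : Vec n → Matrix (Fin n) (Fin n) ℝ) (b : Vec n → Vec n) (τ : Vec n → ℝ)
    (x y u : Vec n) :
    ∑ i, u i * sprayDev a b τ i x y = τ x * (alphaOf a x y ^ 2 * ∑ i, u i * ((a x)⁻¹ *ᵥ b x) i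
      + (alphaOf a x y - 2 * betaOf b x y) * ∑ i, u i * y i) := by
  rw [← sum_mul_lin₂, Finset.mul_sum]
  exact Finset.sum_congr rfl fun _ _ => by rw [sprayDev]; ring

theorem sum_mulVec_mul_self (h : IsSquareSolution U a b τ lam) (hx : x ∈ U) (y : Vec n) :
    ∑ i, (a x *ᵥ y) i * y i = alphaOf a x y ^ 2 := by
  rw [← h.sum_mul_mulVec_self hx]
  exact Finset.sum_congr rfl fun _ _ => mul_comm _ _

theorem sum_mul_pd_alpha (h : IsSquareSolution U a b τ lam) (hx : x ∈ U) (hy : y ≠ 0) :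
    ∑ k, y k * pdx (alphaOf a) k x y
      = 2 * (∑ m, (a x *ᵥ y) m * sprayOf a m x y) / alphaOf a x y := by
  have := (h.hasPD_alpha hx hy).2
  simp only [pdx]
  simp only [pd] at this
  simp only [this, ← mul_div_assoc, ← Finset.sum_div, sum_mul_sum_conn]

theorem sum_mul_pd_beta (h : IsSquareSolution U a b τ lam) (hx : x ∈ U) (y : Vec n) :
    ∑ k, y k * pdx (betaOf b) k x y
      = τ x * ((1 + 2 * bsq a b x) * alphaOf a x y ^ 2 - 3 * betaOf b x y ^ 2)
        + 2 * ∑ m, b x m * sprayOf a m x y := by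
  have := (h.hasPD_beta hx y).2
  simp only [pdx]
  simp only [pd] at this
  rw [← sum_mul_sum_conn, ← h.sum_mul_mulVec_self hx]
  have e : betaOf b x y ^ 2 = betaOf b x y * ∑ i, b x i * y i := by rw [sq]; rfl
  rw [e]
  simp only [this, Finset.mul_sum, ← Finset.sum_sub_distrib, ← Finset.sum_add_distrib]
  exact Finset.sum_congr rfl fun i _ => by rw [mul_add, Finset.mul_sum]; ring

theorem sum_mul_pd_mulVec (h : IsSquareSolution U a b τ lam) (hx : x ∈ U) (y : Vec n) (l : Fin n) :
    ∑ k, y k * pdx (fun x y => (a x *ᵥ y) l) k x y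
      = 2 * ∑ m, a x l m * sprayOf a m x y + ∑ m, (a x *ᵥ y) m * conn a x y m l := by
  have := (h.hasPD_mulVec hx y l).2
  simp only [pdx]
  simp only [pd] at this
  simp only [this, mul_add, Finset.sum_add_distrib, sum_mul_sum_conn, sum_mul_sum_christoffel]

theorem sum_mul_pd_form (h : IsSquareSolution U a b τ lam) (hx : x ∈ U) (y : Vec n) (l : Fin n) :
    ∑ k, y k * pd (fun x => b x l) k x
      = τ x * ((1 + 2 * bsq a b x) * (a x *ᵥ y) l - 3 * b x l * betaOf b x y)
        + ∑ m, b x m * conn a x y m l := by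
  have e : (a x *ᵥ y) l = ∑ k, a x l k * y k := rfl
  rw [← sum_mul_sum_christoffel, e]
  simp only [(h.hasPD_form hx l).2, betaOf, Finset.mul_sum, ← Finset.sum_sub_distrib,
    ← Finset.sum_add_distrib]
  exact Finset.sum_congr rfl fun i _ => by rw [mul_add, Finset.mul_sum]; ring

/-- The spray of the square metric differs from that of `α` by `sprayDev`. -/
theorem geoCoeff_eq (h : IsSquareSolution U a b τ lam) (hx : x ∈ U) (hy : y ≠ 0) (i : Fin n) :
    geoCoeff (sqMetric a b) i x y = sprayOf a i x y + sprayDev a b τ i x y := by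
  have h0 := (h.alpha_pos hx hy).ne'
  have hα := (HasPD.of_differentiableAt (h.hasPD_alpha hx hy).1)
  have hβ := (HasPD.of_differentiableAt (h.hasPD_beta hx y).1)
  have key : ∀ l, (∑ k, y k * pdx (fun x y => pdy (fun x y => (sqMetric a b x y)^2) l x y) k x y)
      - pdx (fun x y => (sqMetric a b x y)^2) l x y
      = 4 * (fundTensor (sqMetric a b) x y *ᵥ
          fun i => sprayOf a i x y + sprayDev a b τ i x y) l := fun l => by
    have h1 := (((hα.coeffP hβ h0).mul
      (HasPD.of_differentiableAt (h.hasPD_mulVec hx y l).1)).add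
      ((hα.coeffQ hβ h0).mul (HasPD.of_differentiableAt (h.hasPD_form hx l).1))
      ).congr_of_eventuallyEq
      (g := fun x => pdy (fun x y => sqMetric a b x y ^ 2) l x y)
      ((h.isOpen.eventually_mem hx).mono fun z hz => h.pdy_sq hz hy l)
    have h2 := ((h.hasPD_alpha hx hy).sqMetric_sq (h.hasPD_beta hx y) h0).2 l
    have e1 : ∑ k, y k * pdx (fun x y => pdy (fun x y => (sqMetric a b x y)^2) l x y) k x y
        = (coeffS (alphaOf a x y) (betaOf b x y) * alphaOf a x y * (a x *ᵥ y) l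
            + coeffT (alphaOf a x y) (betaOf b x y) * alphaOf a x y * b x l)
            * ∑ k, y k * pdx (alphaOf a) k x y
          + (coeffT (alphaOf a x y) (betaOf b x y) * (a x *ᵥ y) l
            + coeffR (alphaOf a x y) (betaOf b x y) * b x l)
            * ∑ k, y k * pdx (betaOf b) k x y
          + coeffP (alphaOf a x y) (betaOf b x y)
            * ∑ k, y k * pdx (fun x y => (a x *ᵥ y) l) k x y
          + coeffQ (alphaOf a x y) (betaOf b x y) * ∑ k, y k * pd (fun x => b x l) k x := by
      simp only [Finset.mul_sum, ← Finset.sum_add_distrib]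
      refine Finset.sum_congr rfl fun k _ => ?_
      refine (congrArg (y k * ·) (h1.2 k)).trans ?_
      simp only [pdx, pd]
      ring
    have e2 : pdx (fun x y => (sqMetric a b x y)^2) l x y = _ := h2
    rw [e1, e2, h.sum_mul_pd_alpha hx hy, h.sum_mul_pd_beta hx, h.sum_mul_pd_mulVec hx,
      h.sum_mul_pd_form hx, h.fundTensor_mulVec hx hy]
    have e3 : (a x *ᵥ fun i => sprayOf a i x y + sprayDev a b τ i x y) l
        = ∑ m, a x l m * sprayOf a m x y + ∑ m, a x l m * sprayDev a b τ m x y := by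
      simp only [Matrix.mulVec, dotProduct, mul_add, Finset.sum_add_distrib]
    have e4 : ∑ m, a x l m * ((a x)⁻¹ *ᵥ b x) m = b x l := h.mulVec_inv_mulVec hx (b x) l
    have e5 : ∑ m, a x l m * y m = (a x *ᵥ y) l := rfl
    have e6 : ∑ m, b x m * y m = betaOf b x y := rfl
    rw [e3]
    simp only [mul_add, Finset.sum_add_distrib, sum_mul_sprayDev, e4, e5, e6, bsq_eq,
      h.sum_form_mul_raised hx, h.sum_mulVec_mul_self hx]
    simp only [coeffP, coeffQ, coeffS, coeffT, coeffR]
    field_simp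
    ring
  have hinv : ((fundTensor (sqMetric a b) x y)⁻¹ *ᵥ (fundTensor (sqMetric a b) x y *ᵥ
      fun i => sprayOf a i x y + sprayDev a b τ i x y)) i
      = sprayOf a i x y + sprayDev a b τ i x y := by
    rw [Matrix.mulVec_mulVec, Matrix.nonsing_inv_mul _ (h.det_fundTensor_ne_zero hx hy).isUnit,
      Matrix.one_mulVec]
  rw [← hinv, geoCoeff]
  simp only [key]
  change _ = ∑ l, (fundTensor (sqMetric a b) x y)⁻¹ i l * (fundTensor (sqMetric a b) x y *ᵥ
      fun i => sprayOf a i x y + sprayDev a b τ i x y) l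
  rw [Finset.mul_sum]
  exact Finset.sum_congr rfl fun l _ => by ring

/-- The partial derivatives of `sprayDev` in the fibre variable. -/
def sprayDevFiber {n : ℕ} (a : Vec n → Matrix (Fin n) (Fin n) ℝ) (b : Vec n → Vec n)
    (τ : Vec n → ℝ) (i k : Fin n) (x y : Vec n) : ℝ :=
  τ x * (2 * (a x *ᵥ y) k * ((a x)⁻¹ *ᵥ b x) i
    + ((a x *ᵥ y) k / alphaOf a x y - 2 * b x k) * y i
    + (alphaOf a x y - 2 * betaOf b x y) * (if i = k then 1 else 0))

theorem hasPD_sprayDev_fiber (h : IsSquareSolution U a b τ lam) (hx : x ∈ U) (hy : y ≠ 0)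
    (i : Fin n) :
    HasPD (fun y => sprayDev a b τ i x y) (fun k => sprayDevFiber a b τ i k x y) y := by
  have hα := h.hasPD_alpha_fiber hx hy
  have hβ := hasPD_beta_fiber b x y
  have h0 := (h.alpha_pos hx hy).ne'
  refine ((((hα.pow 2).mul_const (((a x)⁻¹ *ᵥ b x) i)).add
    ((hα.sub (hβ.const_mul 2)).mul (HasPD.coord i))).const_mul (τ x)).congr fun k => ?_
  simp only [sprayDevFiber, Nat.add_one_sub_one, pow_one, Nat.cast_ofNat]
  field_simp
  ring

theorem hasPD_sprayDev (h : IsSquareSolution U a b τ lam) (hx : x ∈ U) (hy : y ≠ 0) (i : Fin n) :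
    HasPD (fun x => sprayDev a b τ i x y) (fun k =>
      (-(7 + 4 * bsq a b x) * (τ x)^2 - lam x) * b x k *
        (alphaOf a x y ^ 2 * ((a x)⁻¹ *ᵥ b x) i + (alphaOf a x y - 2 * betaOf b x y) * y i)
      + τ x * (2 * (∑ m, (a x *ᵥ y) m * conn a x y m k) * ((a x)⁻¹ *ᵥ b x) i
        + alphaOf a x y ^ 2 * (τ x * ((1 + 2 * bsq a b x) * (if i = k then 1 else 0)
          - 3 * ((a x)⁻¹ *ᵥ b x) i * b x k)
        - ∑ j, christoffel a i k j x * ((a x)⁻¹ *ᵥ b x) j)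
        + ((∑ m, (a x *ᵥ y) m * conn a x y m k) / alphaOf a x y
          - 2 * (τ x * ((1 + 2 * bsq a b x) * (a x *ᵥ y) k - 3 * b x k * betaOf b x y)
            + ∑ m, b x m * conn a x y m k)) * y i)) x := by
  have hα := h.hasPD_alpha hx hy
  have hβ := h.hasPD_beta hx y
  have h0 := (h.alpha_pos hx hy).ne'
  refine ((h.hasPD_tau hx).mul (((hα.pow 2).mul (h.hasPD_raised hx i)).add
    ((hα.sub (hβ.const_mul 2)).mul_const (y i)))).congr fun k => ?_
  simp only [Nat.add_one_sub_one, pow_one, Nat.cast_ofNat]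
  field_simp

theorem sum_mul_pd_raised (h : IsSquareSolution U a b τ lam) (hx : x ∈ U) (y : Vec n)
    (i : Fin n) :
    ∑ k, y k * pd (fun x => ((a x)⁻¹ *ᵥ b x) i) k x
      = τ x * ((1 + 2 * bsq a b x) * y i - 3 * ((a x)⁻¹ *ᵥ b x) i * betaOf b x y)
        - ∑ m, conn a x y i m * ((a x)⁻¹ *ᵥ b x) m := by
  have e1 : ∑ k, y k * ∑ j, christoffel a i k j x * ((a x)⁻¹ *ᵥ b x) j
      = ∑ m, conn a x y i m * ((a x)⁻¹ *ᵥ b x) m := by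
    simp only [conn, Finset.mul_sum, Finset.sum_mul]
    rw [Finset.sum_comm]
    refine Finset.sum_congr rfl fun m _ => Finset.sum_congr rfl fun j _ => ?_
    rw [h.christoffel_symm hx i j m]; ring
  have e2 : y i = ∑ k, y k * (if i = k then 1 else 0) := by simp
  rw [← e1, betaOf]
  rw [e2]
  simp only [(h.hasPD_raised hx i).2, Finset.mul_sum, ← Finset.sum_sub_distrib]
  refine Finset.sum_congr rfl fun k _ => ?_
  rw [← Finset.mul_sum]
  ring

theorem sum_mul_pd_tau (h : IsSquareSolution U a b τ lam) (hx : x ∈ U) (y : Vec n) :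
    ∑ k, y k * pd τ k x = (-(7 + 4 * bsq a b x) * (τ x)^2 - lam x) * betaOf b x y := by
  simp only [(h.hasPD_tau hx).2, betaOf, Finset.mul_sum]
  exact Finset.sum_congr rfl fun k _ => by ring

theorem hasPD_sprayDevFiber (h : IsSquareSolution U a b τ lam) (hx : x ∈ U)
    (hy : y ≠ 0) (i k : Fin n) :
    HasPD (fun x => sprayDevFiber a b τ i k x y) (fun j =>
      pd τ j x * (2 * (a x *ᵥ y) k * ((a x)⁻¹ *ᵥ b x) i
        + ((a x *ᵥ y) k / alphaOf a x y - 2 * b x k) * y i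
        + (alphaOf a x y - 2 * betaOf b x y) * (if i = k then 1 else 0))
      + τ x * (2 * pdx (fun x y => (a x *ᵥ y) k) j x y * ((a x)⁻¹ *ᵥ b x) i
        + 2 * (a x *ᵥ y) k * pd (fun x => ((a x)⁻¹ *ᵥ b x) i) j x
        + (pdx (fun x y => (a x *ᵥ y) k) j x y / alphaOf a x y
          - (a x *ᵥ y) k * pdx (alphaOf a) j x y / alphaOf a x y ^ 2
          - 2 * pd (fun x => b x k) j x) * y i
        + (pdx (alphaOf a) j x y - 2 * pdx (betaOf b) j x y) * (if i = k then 1 else 0))) x := by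
  have hα := HasPD.of_differentiableAt (h.hasPD_alpha hx hy).1
  have hβ := HasPD.of_differentiableAt (h.hasPD_beta hx y).1
  have hl := HasPD.of_differentiableAt (h.hasPD_mulVec hx y k).1
  have hb := HasPD.of_differentiableAt (h.hasPD_form hx k).1
  have hr := HasPD.of_differentiableAt (h.hasPD_raised hx i).1
  have ht := HasPD.of_differentiableAt (h.hasPD_tau hx).1
  have h0 := (h.alpha_pos hx hy).ne'
  refine (ht.mul ((((hl.const_mul 2).mul hr).add
    (((hl.div hα h0).sub (hb.const_mul 2)).mul_const (y i))).add
    ((hα.sub (hβ.const_mul 2)).mul_const (if i = k then 1 else 0)))).congr fun j => ?_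
  simp only [pdx, pd]

theorem sum_mul_pd_sprayDevFiber (h : IsSquareSolution U a b τ lam) (hx : x ∈ U)
    (hy : y ≠ 0) (i k : Fin n) :
    ∑ j, y j * pdx (fun x y => sprayDevFiber a b τ i k x y) j x y
      = (-(7 + 4 * bsq a b x) * (τ x)^2 - lam x) * betaOf b x y
        * (2 * (a x *ᵥ y) k * ((a x)⁻¹ *ᵥ b x) i
          + ((a x *ᵥ y) k / alphaOf a x y - 2 * b x k) * y i
          + (alphaOf a x y - 2 * betaOf b x y) * (if i = k then 1 else 0))
      + τ x * (2 * (2 * ∑ m, a x k m * sprayOf a m x y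
            + ∑ m, (a x *ᵥ y) m * conn a x y m k) * ((a x)⁻¹ *ᵥ b x) i
        + 2 * (a x *ᵥ y) k
          * (τ x * ((1 + 2 * bsq a b x) * y i - 3 * ((a x)⁻¹ *ᵥ b x) i * betaOf b x y)
            - ∑ m, conn a x y i m * ((a x)⁻¹ *ᵥ b x) m)
        + ((2 * ∑ m, a x k m * sprayOf a m x y
            + ∑ m, (a x *ᵥ y) m * conn a x y m k) / alphaOf a x y
          - (a x *ᵥ y) k * (2 * (∑ m, (a x *ᵥ y) m * sprayOf a m x y) / alphaOf a x y)
            / alphaOf a x y ^ 2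
          - 2 * (τ x * ((1 + 2 * bsq a b x) * (a x *ᵥ y) k - 3 * b x k * betaOf b x y)
            + ∑ m, b x m * conn a x y m k)) * y i
        + (2 * (∑ m, (a x *ᵥ y) m * sprayOf a m x y) / alphaOf a x y
          - 2 * (τ x * ((1 + 2 * bsq a b x) * alphaOf a x y ^ 2 - 3 * betaOf b x y ^ 2)
            + 2 * ∑ m, b x m * sprayOf a m x y)) * (if i = k then 1 else 0)) := by
  rw [← h.sum_mul_pd_tau hx, ← h.sum_mul_pd_raised hx, ← h.sum_mul_pd_form hx,
    ← h.sum_mul_pd_mulVec hx, ← h.sum_mul_pd_alpha hx hy, ← h.sum_mul_pd_beta hx]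
  simp only [Finset.sum_mul, Finset.mul_sum, ← Finset.sum_sub_distrib, ← Finset.sum_add_distrib,
    Finset.sum_div]
  refine Finset.sum_congr rfl fun j _ =>
    (congrArg (y j * ·) ((h.hasPD_sprayDevFiber hx hy i k).2 j)).trans ?_
  ring

theorem hasPD_sprayDevFiber_fiber (h : IsSquareSolution U a b τ lam) (hx : x ∈ U)
    (hy : y ≠ 0) (i k : Fin n) :
    HasPD (fun y => sprayDevFiber a b τ i k x y) (fun j =>
      τ x * (2 * a x k j * ((a x)⁻¹ *ᵥ b x) i
        + (a x k j / alphaOf a x y - (a x *ᵥ y) k * (a x *ᵥ y) j / alphaOf a x y ^ 3) * y i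
        + ((a x *ᵥ y) k / alphaOf a x y - 2 * b x k) * (if i = j then 1 else 0)
        + ((a x *ᵥ y) j / alphaOf a x y - 2 * b x j) * (if i = k then 1 else 0))) y := by
  have hα := h.hasPD_alpha_fiber hx hy
  have hβ := hasPD_beta_fiber b x y
  have hl := IsMetricOn.hasPD_mulVec_fiber (a x) y k
  have h0 := (h.alpha_pos hx hy).ne'
  refine (((((hl.const_mul 2).mul_const (((a x)⁻¹ *ᵥ b x) i)).add
    (((hl.div hα h0).sub (HasPD.const (2 * b x k))).mul (HasPD.coord i))).add
    ((hα.sub (hβ.const_mul 2)).mul_const (if i = k then 1 else 0))).const_mul (τ x)).congr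
    fun j => ?_
  field_simp
  ring

theorem sum_mul_pd_sprayDevFiber_fiber (h : IsSquareSolution U a b τ lam) (hx : x ∈ U)
    (hy : y ≠ 0) (i k : Fin n) (w : Fin n → ℝ) :
    ∑ j, w j * pdy (fun x y => sprayDevFiber a b τ i k x y) j x y
      = τ x * (2 * (∑ j, a x k j * w j) * ((a x)⁻¹ *ᵥ b x) i
        + ((∑ j, a x k j * w j) / alphaOf a x y
          - (a x *ᵥ y) k * (∑ j, (a x *ᵥ y) j * w j) / alphaOf a x y ^ 3) * y i
        + ((a x *ᵥ y) k / alphaOf a x y - 2 * b x k) * w i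
        + ((∑ j, (a x *ᵥ y) j * w j) / alphaOf a x y - 2 * ∑ j, b x j * w j)
          * (if i = k then 1 else 0)) := by
  have e : w i = ∑ j, w j * (if i = j then 1 else 0) := by simp
  rw [e]
  simp only [Finset.sum_mul, Finset.mul_sum, ← Finset.sum_sub_distrib, ← Finset.sum_add_distrib,
    Finset.sum_div]
  refine Finset.sum_congr rfl fun j _ =>
    (congrArg (w j * ·) ((h.hasPD_sprayDevFiber_fiber hx hy i k).2 j)).trans ?_
  ring

theorem sum_sprayDevFiber_mul (a : Vec n → Matrix (Fin n) (Fin n) ℝ) (b : Vec n → Vec n)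
    (τ : Vec n → ℝ) (x y : Vec n) (i : Fin n) (w : Fin n → ℝ) :
    ∑ j, sprayDevFiber a b τ i j x y * w j
      = τ x * (2 * (∑ j, (a x *ᵥ y) j * w j) * ((a x)⁻¹ *ᵥ b x) i
        + ((∑ j, (a x *ᵥ y) j * w j) / alphaOf a x y - 2 * ∑ j, b x j * w j) * y i
        + (alphaOf a x y - 2 * betaOf b x y) * w i) := by
  have e : w i = ∑ j, w j * (if i = j then 1 else 0) := by simp
  rw [e]
  simp only [Finset.sum_mul, Finset.mul_sum, ← Finset.sum_sub_distrib, ← Finset.sum_add_distrib,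
    Finset.sum_div]
  exact Finset.sum_congr rfl fun j _ => by rw [sprayDevFiber]; ring

theorem sum_mul_sprayDevFiber (a : Vec n → Matrix (Fin n) (Fin n) ℝ) (b : Vec n → Vec n)
    (τ : Vec n → ℝ) (x y : Vec n) (k : Fin n) (u : Fin n → ℝ) :
    ∑ j, u j * sprayDevFiber a b τ j k x y
      = τ x * (2 * (a x *ᵥ y) k * (∑ j, u j * ((a x)⁻¹ *ᵥ b x) j)
        + ((a x *ᵥ y) k / alphaOf a x y - 2 * b x k) * (∑ j, u j * y j)
        + (alphaOf a x y - 2 * betaOf b x y) * u k) := by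
  have e : u k = ∑ j, u j * (if j = k then 1 else 0) := by simp
  rw [e]
  simp only [Finset.mul_sum, ← Finset.sum_add_distrib]
  exact Finset.sum_congr rfl fun j _ => by rw [sprayDevFiber]; ring

theorem pdy_geoCoeff (h : IsSquareSolution U a b τ lam) (hx : x ∈ U) (hy : y ≠ 0) (i k : Fin n) :
    pdy (geoCoeff (sqMetric a b) i) k x y = conn a x y i k + sprayDevFiber a b τ i k x y :=
  (((h.hasPD_spray_fiber hx y i).add (h.hasPD_sprayDev_fiber hx hy i)).congr_of_eventuallyEq
    (g := fun y => geoCoeff (sqMetric a b) i x y)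
    ((isOpen_ne.eventually_mem hy).mono fun _ hz => h.geoCoeff_eq hx hz i)).2 k

theorem curvOfSpray_sprayOf (h : IsSquareSolution U a b τ lam) (hx : x ∈ U) (y : Vec n)
    (i k : Fin n) :
    curvOfSpray (sprayOf a) i k x y = 2 * pdx (sprayOf a i) k x y
      - ∑ j, y j * pdx (fun x y => conn a x y i k) j x y
      + 2 * ∑ j, sprayOf a j x y * christoffel a i k j x
      - ∑ j, conn a x y i j * conn a x y j k := by
  have h1 : ∀ z ∈ U, ∀ w i k, pdy (sprayOf a i) k z w = conn a z w i k := fun z hz w i k =>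
    (h.hasPD_spray_fiber hz w i).2 k
  have h2 : ∀ j, pdx (fun x y => pdy (sprayOf a i) k x y) j x y
      = pdx (fun x y => conn a x y i k) j x y := fun j => by
    have : (fun x => pdy (sprayOf a i) k x y) =ᶠ[𝓝 x] fun x => conn a x y i k :=
      (h.isOpen.eventually_mem hx).mono fun z hz => h1 z hz y i k
    simp only [pdx, this.fderiv_eq]
  have h3 : ∀ j, pdy (fun x y => pdy (sprayOf a i) k x y) j x y = christoffel a i k j x := fun j => by
    simp only [pdy] at h1 ⊢
    simp only [h1 x hx]
    exact (IsMetricOn.hasPD_conn_fiber y i k).2 j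
  simp only [curvOfSpray, h2, h3, h1 x hx]

theorem curvOfSpray_geoCoeff (h : IsSquareSolution U a b τ lam) (hx : x ∈ U) (hy : y ≠ 0)
    (i k : Fin n) :
    curvOfSpray (geoCoeff (sqMetric a b)) i k x y = curvOfSpray (sprayOf a) i k x y
      + 2 * pdx (sprayDev a b τ i) k x y
      - ∑ j, y j * pdx (fun x y => sprayDevFiber a b τ i k x y) j x y
      + 2 * ∑ j, christoffel a i k j x * sprayDev a b τ j x y
      + 2 * ∑ j, sprayOf a j x y * pdy (fun x y => sprayDevFiber a b τ i k x y) j x y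
      + 2 * ∑ j, sprayDev a b τ j x y * pdy (fun x y => sprayDevFiber a b τ i k x y) j x y
      - ∑ j, conn a x y i j * sprayDevFiber a b τ j k x y
      - ∑ j, sprayDevFiber a b τ i j x y * conn a x y j k
      - ∑ j, sprayDevFiber a b τ i j x y * sprayDevFiber a b τ j k x y := by
  have h1 : pdx (geoCoeff (sqMetric a b) i) k x y
      = pdx (sprayOf a i) k x y + pdx (sprayDev a b τ i) k x y :=
    (((HasPD.of_differentiableAt (h.differentiableAt_spray hx y i)).add
      (HasPD.of_differentiableAt (h.hasPD_sprayDev hx hy i).1)).congr_of_eventuallyEq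
      (g := fun x => geoCoeff (sqMetric a b) i x y)
      ((h.isOpen.eventually_mem hx).mono fun _ hz => h.geoCoeff_eq hz hy i)).2 k
  have h2 : ∀ j, pdx (fun x y => pdy (geoCoeff (sqMetric a b) i) k x y) j x y
      = pdx (fun x y => conn a x y i k) j x y
        + pdx (fun x y => sprayDevFiber a b τ i k x y) j x y := fun j =>
    (((HasPD.of_differentiableAt (h.differentiableAt_conn hx y i k)).add
      (HasPD.of_differentiableAt (h.hasPD_sprayDevFiber hx hy i k).1)
      ).congr_of_eventuallyEq (g := fun x => pdy (geoCoeff (sqMetric a b) i) k x y)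
      ((h.isOpen.eventually_mem hx).mono fun _ hz => h.pdy_geoCoeff hz hy i k)).2 j
  have h3 : ∀ j, pdy (fun x y => pdy (geoCoeff (sqMetric a b) i) k x y) j x y
      = christoffel a i k j x + pdy (fun x y => sprayDevFiber a b τ i k x y) j x y := fun j =>
    (((IsMetricOn.hasPD_conn_fiber y i k).add
      (HasPD.of_differentiableAt (h.hasPD_sprayDevFiber_fiber hx hy i k).1)
      ).congr_of_eventuallyEq (g := fun y => pdy (geoCoeff (sqMetric a b) i) k x y)
      ((isOpen_ne.eventually_mem hy).mono fun _ hz => h.pdy_geoCoeff hx hz i k)).2 j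
  have h4 : ∑ j, christoffel a i k j x * sprayDev a b τ j x y
      = ∑ j, sprayDev a b τ j x y * christoffel a i k j x :=
    Finset.sum_congr rfl fun _ _ => mul_comm _ _
  rw [h.curvOfSpray_sprayOf hx, curvOfSpray, h1, h4]
  simp only [h2, h3, h.pdy_geoCoeff hx hy, h.geoCoeff_eq hx hy, mul_add, add_mul,
    Finset.sum_add_distrib]
  ring

theorem curvOfSpray_sprayOf_eq (h : IsSquareSolution U a b τ lam) (hx : x ∈ U) (y : Vec n)
    (i k : Fin n) :
    curvOfSpray (sprayOf a) i k x y =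
      lam x * ((alphaOf a x y)^2 * (if i = k then (1:ℝ) else 0) - y i * (a x *ᵥ y) k)
      + 2 * (lam x + 4 * (2 + bsq a b x) * (τ x)^2) *
        ((betaOf b x y)^2 * (if i = k then (1:ℝ) else 0)
          + (alphaOf a x y)^2 * ((a x)⁻¹ *ᵥ b x) i * b x k
          - betaOf b x y * ((a x)⁻¹ *ᵥ b x) i * (a x *ᵥ y) k
          - betaOf b x y * b x k * y i) :=
  h.eqns.2.1 x hx y i k

theorem curvature_eq (h : IsSquareSolution U a b τ lam) (hx : x ∈ U) (hy : y ≠ 0)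
    (i k : Fin n) :
    curvOfSpray (geoCoeff (sqMetric a b)) i k x y =
      (alphaOf a x y / (sqMetric a b x y)^2 *
        ((lam x + (τ x)^2 * (5 + 4 * bsq a b x)) * alphaOf a x y
          + ((lam x + 4 * (2 + bsq a b x) * (τ x)^2) - 3 * (τ x)^2) * betaOf b x y)) *
      ((sqMetric a b x y)^2 * (if i = k then (1:ℝ) else 0)
        - y i * (fundTensor (sqMetric a b) x y *ᵥ y) k) := by
  have hα := h.alpha_pos hx hy
  have h0 := hα.ne'
  have hs : alphaOf a x y + betaOf b x y ≠ 0 := by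
    have := (abs_lt.1 (abs_lt_of_sq_lt_sq (h.beta_sq_lt hx hy) hα.le)).1
    linarith
  have e1 : pdx (sprayDev a b τ i) k x y = _ := (h.hasPD_sprayDev hx hy i).2 k
  have e2 : ∑ j, conn a x y i j * y j = 2 * sprayOf a i x y := by
    rw [← sum_mul_conn]
    exact Finset.sum_congr rfl fun _ _ => mul_comm _ _
  have e3 : ∑ m, a x k m * ((a x)⁻¹ *ᵥ b x) m = b x k := h.mulVec_inv_mulVec hx (b x) k
  have e4 : ∑ m, a x k m * y m = (a x *ᵥ y) k := rfl
  have e5 : ∑ m, b x m * y m = betaOf b x y := rfl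
  have e6 : ∑ j, christoffel a i k j x * y j = conn a x y i k := rfl
  rw [h.curvOfSpray_geoCoeff hx hy, h.curvOfSpray_sprayOf_eq hx, e1,
    h.sum_mul_pd_sprayDevFiber hx hy, h.sum_mul_pd_sprayDevFiber_fiber hx hy,
    h.sum_mul_pd_sprayDevFiber_fiber hx hy, h.fundTensor_mulVec hx hy]
  simp only [sum_sprayDevFiber_mul, sum_mul_sprayDevFiber, sum_mul_sprayDev, e2, e3, e4, e5, e6,
    bsq_eq, h.sum_form_mul_raised hx, h.sum_mulVec_mul_self hx]
  simp only [sprayDev, sprayDevFiber, coeffP, coeffS, coeffT, coeffR, sqMetric]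
  generalize (if i = k then (1 : ℝ) else 0) = δ
  field_simp
  ring

end IsSquareSolution

/-- Theorem 3.1 (sufficiency): if (E1)–(E3) hold, then the square metric
`F = (α+β)²/α` is of scalar flag curvature, with scalar flag curvature
`K = (α/F²)·{[λ + τ²(5+4b²)]α + (η − 3τ²)β}` where `η = λ + 4(2+b²)τ²`. -/
theorem stmt_2 {n : ℕ} (hn : 3 ≤ n) (U : Set (Vec n))
    (hU : IsOpen U) (hconn : IsConnected U)
    (a : Vec n → Matrix (Fin n) (Fin n) ℝ) (b : Vec n → Vec n)
    (ha : ∀ i j, ContDiffOn ℝ (⊤ : ℕ∞) (fun x => a x i j) U)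
    (hsym : ∀ x ∈ U, (a x).IsSymm)
    (hpos : ∀ x ∈ U, (a x).PosDef)
    (hb : ∀ i, ContDiffOn ℝ (⊤ : ℕ∞) (fun x => b x i) U)
    (hb2 : ∀ x ∈ U, 0 < bsq a b x ∧ bsq a b x < 1)
    (τ lam : Vec n → ℝ)
    (hτ : ContDiffOn ℝ (⊤ : ℕ∞) τ U) (hlam : ContDiffOn ℝ (⊤ : ℕ∞) lam U)
    (hE : E123 U a b τ lam) :
    ∀ x ∈ U, ∀ y : Vec n, y ≠ 0 → ∀ i k : Fin n,
      curvOfSpray (geoCoeff (sqMetric a b)) i k x y =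
        (alphaOf a x y / (sqMetric a b x y)^2 *
          ((lam x + (τ x)^2 * (5 + 4 * bsq a b x)) * alphaOf a x y
            + ((lam x + 4 * (2 + bsq a b x) * (τ x)^2) - 3 * (τ x)^2) * betaOf b x y)) *
        ((sqMetric a b x y)^2 * (if i = k then (1:ℝ) else 0)
          - y i * ∑ j, fundTensor (sqMetric a b) x y k j * y j) := by
  intro x hx y hy i k
  have h : IsSquareSolution U a b τ lam :=
    { isOpen := hU
      contDiffOn := ha
      symm := hsym
      posDef := hpos
      differentiableAt_form := fun x hx i =>
        ((hb i).contDiffAt (hU.mem_nhds hx)).differentiableAt (by simp)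
      differentiableAt_tau := fun x hx => (hτ.contDiffAt (hU.mem_nhds hx)).differentiableAt (by simp)
      bsq_pos := fun x hx => (hb2 x hx).1
      bsq_lt_one := fun x hx => (hb2 x hx).2
      eqns := hE }
  exact h.curvature_eq hx hy i k
end
end

section
/- Let n ≥ 3 and suppose that on a connected open set U ⊆ ℝⁿ the data (a_{ij}, b_i) satisfy conditions (E1)–(E3) with smooth functions τ(x), λ(x). Define h_{ij} := (1−b²)²·a_{ij} and w_i := (1−b²)^{1/2}·b_i on U. Then: (i) the function μ := (λ + 4(1+b²)τ²)/(1−b²)² is constant on U, and the Riemann curvature of the Riemannian metric h := √(h_{ij}yⁱyʲ) satisfies R̃ⁱ_k = μ·(h²δⁱ_k − yⁱỹ_k), where ỹ_k := h_{kj}yʲ (so h has constant sectional curvature μ, and λ = μ(1−b²)² − 4(1+b²)τ²); and (ii) the covariant derivative of w with respect to h satisfies w_{i|j} = τ·(1−b²)^{−3/2}·h_{ij}; in particular the 1-form ω := w_iyⁱ is closed and conformal with respect to h. -/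
open scoped BigOperators

noncomputable section

/-- The deformed metric `h_{ij} = (1−b²)² a_{ij}`. -/
def hOf {n : ℕ} (a : Vec n → Matrix (Fin n) (Fin n) ℝ) (b : Vec n → Vec n)
    (x : Vec n) : Matrix (Fin n) (Fin n) ℝ :=
  Matrix.of fun i j => (1 - bsq a b x)^2 * a x i j

/-- The deformed 1-form `w_i = (1−b²)^{1/2} b_i`. -/
def wOf {n : ℕ} (a : Vec n → Matrix (Fin n) (Fin n) ℝ) (b : Vec n → Vec n)
    (x : Vec n) : Vec n :=
  fun i => Real.sqrt (1 - bsq a b x) * b x i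

section PartialDerivatives

variable {n : ℕ} {U : Set (Vec n)} {f g : Vec n → ℝ} {x : Vec n}

lemma pd_add (hf : DifferentiableAt ℝ f x) (hg : DifferentiableAt ℝ g x) (k : Fin n) :
    pd (fun x => f x + g x) k x = pd f k x + pd g k x := by
  simp [pd, fderiv_fun_add hf hg]

lemma pd_sub (hf : DifferentiableAt ℝ f x) (hg : DifferentiableAt ℝ g x) (k : Fin n) :
    pd (fun x => f x - g x) k x = pd f k x - pd g k x := by
  simp [pd, fderiv_fun_sub hf hg]

lemma pd_mul (hf : DifferentiableAt ℝ f x) (hg : DifferentiableAt ℝ g x) (k : Fin n) :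
    pd (fun x => f x * g x) k x = pd f k x * g x + f x * pd g k x := by
  simp [pd, fderiv_fun_mul hf hg]
  ring

lemma pd_const (c : ℝ) (k : Fin n) : pd (fun _ => c) k x = 0 := by
  simp [pd]

lemma pd_const_mul (hf : DifferentiableAt ℝ f x) (c : ℝ) (k : Fin n) :
    pd (fun x => c * f x) k x = c * pd f k x := by
  simp [pd_mul (differentiableAt_const c) hf, pd_const]

lemma pd_sum {ι : Type*} {s : Finset ι} {F : ι → Vec n → ℝ}
    (hF : ∀ i ∈ s, DifferentiableAt ℝ (F i) x) (k : Fin n) :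
    pd (fun x => ∑ i ∈ s, F i x) k x = ∑ i ∈ s, pd (F i) k x := by
  simp [pd, fderiv_fun_sum hF]

lemma pd_coord (j k : Fin n) : pd (fun y => y j) k x = if j = k then 1 else 0 := by
  simp only [pd]
  rw [(hasFDerivAt_apply j x).fderiv]
  simp [Pi.single_apply]

lemma pd_congr (hU : IsOpen U) (h : ∀ x ∈ U, f x = g x) (hx : x ∈ U) (k : Fin n) :
    pd f k x = pd g k x := by
  have : f =ᶠ[nhds x] g := Filter.eventually_of_mem (hU.mem_nhds hx) h
  simp [pd, this.fderiv_eq]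

lemma ContDiffOn.differentiableAt_of_isOpen (hf : ContDiffOn ℝ (⊤ : ℕ∞) f U) (hU : IsOpen U)
    (hx : x ∈ U) : DifferentiableAt ℝ f x :=
  (hf.contDiffAt (hU.mem_nhds hx)).differentiableAt (by simp)

lemma contDiffOn_pd (hU : IsOpen U) (hf : ContDiffOn ℝ (⊤ : ℕ∞) f U) (k : Fin n) :
    ContDiffOn ℝ (⊤ : ℕ∞) (pd f k) U :=
  (hf.fderiv_of_isOpen hU (by simp)).clm_apply contDiffOn_const

lemma pd_comm (hU : IsOpen U) (hf : ContDiffOn ℝ (⊤ : ℕ∞) f U) (hx : x ∈ U) (j k : Fin n) :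
    pd (pd f j) k x = pd (pd f k) j x := by
  have hfx := hf.contDiffAt (hU.mem_nhds hx)
  have hd : DifferentiableAt ℝ (fderiv ℝ f) x :=
    ((hf.fderiv_of_isOpen (m := (⊤ : ℕ∞)) hU (by simp)).contDiffAt
      (hU.mem_nhds hx)).differentiableAt (by simp)
  have hs : IsSymmSndFDerivAt ℝ f x := hfx.isSymmSndFDerivAt (by
    simpa using WithTop.coe_le_coe.2 (le_top (a := (2 : ℕ∞))))
  have key : ∀ i l : Fin n, pd (pd f i) l x
      = fderiv ℝ (fderiv ℝ f) x (Pi.single l 1) (Pi.single i 1) := by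
    intro i l
    change fderiv ℝ (fun x => fderiv ℝ f x (Pi.single i 1)) x (Pi.single l 1) = _
    rw [fderiv_clm_apply hd (differentiableAt_const _)]
    simp
  rw [key, key, hs.eq]

end PartialDerivatives

/-- The vector field obtained from a 1-form by raising its index. -/
def raise {n : ℕ} (g : Vec n → Matrix (Fin n) (Fin n) ℝ) (b : Vec n → Vec n) (i : Fin n)
    (x : Vec n) : ℝ := ∑ j, (g x)⁻¹ i j * b x j

/-- The Riemann curvature tensor `Rⁱ_{jkl}` of a metric field. -/
def riem {n : ℕ} (g : Vec n → Matrix (Fin n) (Fin n) ℝ) (i j k l : Fin n) (x : Vec n) : ℝ :=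
  pd (christoffel g i l j) k x - pd (christoffel g i k j) l x
    + ∑ m, christoffel g i k m x * christoffel g m l j x
    - ∑ m, christoffel g i l m x * christoffel g m k j x

/-- A smooth nondegenerate symmetric 2-tensor field on an open set. -/
structure IsSmoothMetricOn {n : ℕ} (U : Set (Vec n)) (g : Vec n → Matrix (Fin n) (Fin n) ℝ) :
    Prop where
  isOpen : IsOpen U
  smooth : ∀ i j, ContDiffOn ℝ (⊤ : ℕ∞) (fun x => g x i j) U
  symm : ∀ x ∈ U, ∀ i j, g x i j = g x j i
  isUnit_det : ∀ x ∈ U, IsUnit (g x).det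

namespace IsSmoothMetricOn

variable {n : ℕ} {U : Set (Vec n)} {g : Vec n → Matrix (Fin n) (Fin n) ℝ} {b : Vec n → Vec n}
  {x : Vec n}

lemma sum_mul_inv (hg : IsSmoothMetricOn U g) (hx : x ∈ U) (i k : Fin n) :
    ∑ j, g x i j * (g x)⁻¹ j k = if i = k then 1 else 0 := by
  rw [← Matrix.mul_apply, Matrix.mul_nonsing_inv _ (hg.isUnit_det x hx), Matrix.one_apply]

lemma sum_inv_mul (hg : IsSmoothMetricOn U g) (hx : x ∈ U) (i k : Fin n) :
    ∑ j, (g x)⁻¹ i j * g x j k = if i = k then 1 else 0 := by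
  rw [← Matrix.mul_apply, Matrix.nonsing_inv_mul _ (hg.isUnit_det x hx), Matrix.one_apply]

lemma sum_mul_sum_inv_mul (hg : IsSmoothMetricOn U g) (hx : x ∈ U) (v : Fin n → ℝ) (i : Fin n) :
    ∑ j, g x i j * ∑ k, (g x)⁻¹ j k * v k = v i := by
  simp only [Finset.mul_sum, ← mul_assoc]
  rw [Finset.sum_comm]
  simp only [← Finset.sum_mul, hg.sum_mul_inv hx]
  simp

lemma sum_inv_mul_sum_mul (hg : IsSmoothMetricOn U g) (hx : x ∈ U) (v : Fin n → ℝ) (i : Fin n) :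
    ∑ j, (g x)⁻¹ i j * ∑ k, g x j k * v k = v i := by
  simp only [Finset.mul_sum, ← mul_assoc]
  rw [Finset.sum_comm]
  simp only [← Finset.sum_mul, hg.sum_inv_mul hx]
  simp

lemma contDiffOn_det {ι : Type*} [Fintype ι] [DecidableEq ι] {M : Vec n → Matrix ι ι ℝ}
    (hM : ∀ i j, ContDiffOn ℝ (⊤ : ℕ∞) (fun x => M x i j) U) :
    ContDiffOn ℝ (⊤ : ℕ∞) (fun x => (M x).det) U := by
  simp only [Matrix.det_apply]
  refine ContDiffOn.sum fun σ _ => ContDiffOn.const_smul _ ?_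
  exact contDiffOn_prod fun i _ => hM _ _

lemma contDiffOn_inv (hg : IsSmoothMetricOn U g) (i j : Fin n) :
    ContDiffOn ℝ (⊤ : ℕ∞) (fun x => (g x)⁻¹ i j) U := by
  have h : ∀ x, (g x)⁻¹ i j = ((g x).det)⁻¹ * ((g x).updateRow j (Pi.single i 1)).det := by
    intro x
    simp [Matrix.inv_def, Matrix.adjugate_apply]
  simp only [h]
  refine ((contDiffOn_det hg.smooth).inv fun x hx => (hg.isUnit_det x hx).ne_zero).mul
    (contDiffOn_det fun p q => ?_)
  by_cases hp : p = j
  · subst hp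
    simpa using contDiffOn_const
  · simpa [Matrix.updateRow_ne hp] using hg.smooth p q

lemma contDiffOn_christoffel (hg : IsSmoothMetricOn U g) (k i j : Fin n) :
    ContDiffOn ℝ (⊤ : ℕ∞) (christoffel g k i j) U :=
  contDiffOn_const.mul <| ContDiffOn.sum fun l _ => (hg.contDiffOn_inv k l).mul <|
    ((contDiffOn_pd hg.isOpen (hg.smooth l i) j).add
      (contDiffOn_pd hg.isOpen (hg.smooth l j) i)).sub (contDiffOn_pd hg.isOpen (hg.smooth i j) l)

lemma contDiffOn_raise (hg : IsSmoothMetricOn U g)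
    (hb : ∀ i, ContDiffOn ℝ (⊤ : ℕ∞) (fun x => b x i) U) (i : Fin n) :
    ContDiffOn ℝ (⊤ : ℕ∞) (raise g b i) U :=
  ContDiffOn.sum fun j _ => (hg.contDiffOn_inv i j).mul (hb j)

lemma pd_symm (hg : IsSmoothMetricOn U g) (hx : x ∈ U) (i j k : Fin n) :
    pd (fun x => g x i j) k x = pd (fun x => g x j i) k x :=
  pd_congr hg.isOpen (fun x hx => hg.symm x hx i j) hx k

lemma christoffel_symm (hg : IsSmoothMetricOn U g) (hx : x ∈ U) (k i j : Fin n) :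
    christoffel g k i j x = christoffel g k j i x := by
  unfold christoffel
  congr 1
  refine Finset.sum_congr rfl fun l _ => ?_
  rw [hg.pd_symm hx i j l]
  ring

lemma sum_mul_christoffel (hg : IsSmoothMetricOn U g) (hx : x ∈ U) (l i j : Fin n) :
    ∑ m, g x l m * christoffel g m i j x = (1 / 2) *
      (pd (fun x => g x l i) j x + pd (fun x => g x l j) i x - pd (fun x => g x i j) l x) := by
  rw [← hg.sum_mul_sum_inv_mul hx (fun l => (1 / 2) *
      (pd (fun x => g x l i) j x + pd (fun x => g x l j) i x - pd (fun x => g x i j) l x)) l]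
  refine Finset.sum_congr rfl fun m _ => ?_
  rw [christoffel, Finset.mul_sum]
  congr 1
  refine Finset.sum_congr rfl fun p _ => ?_
  ring

lemma pd_metric (hg : IsSmoothMetricOn U g) (hx : x ∈ U) (i j k : Fin n) :
    pd (fun x => g x i j) k x = ∑ m, g x i m * christoffel g m j k x
      + ∑ m, g x j m * christoffel g m i k x := by
  rw [hg.sum_mul_christoffel hx, hg.sum_mul_christoffel hx, hg.pd_symm hx i k j,
    hg.pd_symm hx j i k, hg.pd_symm hx j k i]
  ring

lemma differentiableAt_christoffel (hg : IsSmoothMetricOn U g) (hx : x ∈ U) (k i j : Fin n) :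
    DifferentiableAt ℝ (christoffel g k i j) x :=
  (hg.contDiffOn_christoffel k i j).differentiableAt_of_isOpen hg.isOpen hx

lemma pdx_sprayOf (hg : IsSmoothMetricOn U g) (hx : x ∈ U) (i k : Fin n) (y : Vec n) :
    pdx (sprayOf g i) k x y
      = (1 / 2) * ∑ j, ∑ l, pd (christoffel g i j l) k x * y j * y l := by
  have hd := hg.differentiableAt_christoffel hx
  change pd (fun x => (1 / 2) * ∑ j, ∑ l, christoffel g i j l x * y j * y l) k x = _
  rw [pd_const_mul (by fun_prop), pd_sum (by fun_prop)]
  congr 1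
  refine Finset.sum_congr rfl fun j _ => ?_
  rw [pd_sum (by fun_prop)]
  refine Finset.sum_congr rfl fun l _ => ?_
  rw [pd_mul (by fun_prop) (by fun_prop), pd_mul (by fun_prop) (by fun_prop), pd_const, pd_const]
  ring

lemma pdy_sprayOf (hg : IsSmoothMetricOn U g) (hx : x ∈ U) (i k : Fin n) (y : Vec n) :
    pdy (sprayOf g i) k x y = ∑ j, christoffel g i j k x * y j := by
  change pd (fun y => (1 / 2) * ∑ j, ∑ l, christoffel g i j l x * y j * y l) k y = _
  rw [pd_const_mul (by fun_prop), pd_sum (by fun_prop)]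
  have h : ∀ j, pd (fun y : Vec n => ∑ l, christoffel g i j l x * y j * y l) k y
      = (if j = k then ∑ l, christoffel g i j l x * y l else 0)
        + christoffel g i j k x * y j := by
    intro j
    rw [pd_sum (by fun_prop)]
    have h2 : ∀ l, pd (fun y : Vec n => christoffel g i j l x * y j * y l) k y
        = (if j = k then christoffel g i j l x * y l else 0)
          + (if l = k then christoffel g i j l x * y j else 0) := by
      intro l
      rw [pd_mul (by fun_prop) (by fun_prop), pd_const_mul (by fun_prop), pd_coord, pd_coord]
      split_ifs <;> ring
    simp only [h2, Finset.sum_add_distrib]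
    congr 1
    · split_ifs <;> simp
    · simp
  simp only [h, Finset.sum_add_distrib]
  rw [Finset.sum_ite_eq' Finset.univ k, if_pos (Finset.mem_univ k)]
  simp only [hg.christoffel_symm hx i k]
  ring

lemma pdx_pdy_sprayOf (hg : IsSmoothMetricOn U g) (hx : x ∈ U) (i k j : Fin n) (y : Vec n) :
    pdx (fun x y => pdy (sprayOf g i) k x y) j x y
      = ∑ l, pd (christoffel g i l k) j x * y l := by
  have hd := hg.differentiableAt_christoffel hx
  change pd (fun x => pdy (sprayOf g i) k x y) j x = _
  rw [pd_congr hg.isOpen (fun x hx => hg.pdy_sprayOf hx i k y) hx, pd_sum (by fun_prop)]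
  refine Finset.sum_congr rfl fun l _ => ?_
  rw [pd_mul (by fun_prop) (by fun_prop), pd_const]
  ring

lemma pdy_pdy_sprayOf (hg : IsSmoothMetricOn U g) (hx : x ∈ U) (i k j : Fin n) (y : Vec n) :
    pdy (fun x y => pdy (sprayOf g i) k x y) j x y = christoffel g i j k x := by
  change pd (fun y => pdy (sprayOf g i) k x y) j y = _
  simp only [hg.pdy_sprayOf hx]
  rw [pd_sum (by fun_prop)]
  have h : ∀ l, pd (fun y : Vec n => christoffel g i l k x * y l) j y
      = if l = j then christoffel g i l k x else 0 := by
    intro l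
    rw [pd_const_mul (by fun_prop), pd_coord]
    split_ifs <;> simp
  simp [h]

lemma curvOfSpray_sprayOf (hg : IsSmoothMetricOn U g) (hx : x ∈ U) (i k : Fin n) (y : Vec n) :
    curvOfSpray (sprayOf g) i k x y = ∑ j, ∑ l, riem g i j k l x * y j * y l := by
  have h1 : ∑ j, y j * ∑ l, pd (christoffel g i l k) j x * y l
      = ∑ j, ∑ l, pd (christoffel g i k j) l x * y j * y l := by
    simp only [Finset.mul_sum]
    rw [Finset.sum_comm]
    refine Finset.sum_congr rfl fun j _ => Finset.sum_congr rfl fun l _ => ?_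
    rw [pd_congr hg.isOpen (fun x hx => hg.christoffel_symm hx i j k) hx]
    ring
  have h2 : ∑ m, sprayOf g m x y * christoffel g i m k x = (1 / 2) *
      ∑ j, ∑ l, (∑ m, christoffel g i k m x * christoffel g m l j x) * y j * y l := by
    simp only [sprayOf, Finset.mul_sum, Finset.sum_mul]
    rw [Finset.sum_comm]
    refine Finset.sum_congr rfl fun j _ => ?_
    rw [Finset.sum_comm]
    refine Finset.sum_congr rfl fun l _ => Finset.sum_congr rfl fun m _ => ?_
    rw [hg.christoffel_symm hx i k m, hg.christoffel_symm hx m l j]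
    ring
  have h3 : ∑ m, (∑ l, christoffel g i l m x * y l) * (∑ j, christoffel g m j k x * y j)
      = ∑ j, ∑ l, (∑ m, christoffel g i l m x * christoffel g m k j x) * y j * y l := by
    simp only [Finset.mul_sum, Finset.sum_mul]
    rw [Finset.sum_comm]
    refine Finset.sum_congr rfl fun j _ => ?_
    rw [Finset.sum_comm]
    refine Finset.sum_congr rfl fun l _ => Finset.sum_congr rfl fun m _ => ?_
    rw [hg.christoffel_symm hx m k j]
    ring
  have h4 : ∑ j, ∑ l, pd (christoffel g i j l) k x * y j * y l
      = ∑ j, ∑ l, pd (christoffel g i l j) k x * y j * y l := by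
    refine Finset.sum_congr rfl fun j _ => Finset.sum_congr rfl fun l _ => ?_
    rw [pd_congr hg.isOpen (fun x hx => hg.christoffel_symm hx i j l) hx]
  simp only [curvOfSpray, hg.pdx_sprayOf hx, hg.pdx_pdy_sprayOf hx, hg.pdy_pdy_sprayOf hx,
    hg.pdy_sprayOf hx, h1, h2, h3, h4]
  simp only [riem, sub_mul, add_mul, Finset.sum_sub_distrib, Finset.sum_add_distrib]
  ring

lemma riem_swap (i j k l : Fin n) : riem g i j l k x = - riem g i j k l x := by
  unfold riem
  ring

lemma riem_cyclic (hg : IsSmoothMetricOn U g) (hx : x ∈ U) (i j k l : Fin n) :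
    riem g i j k l x + riem g i k l j x + riem g i l j k x = 0 := by
  have h : ∀ p q r, pd (christoffel g i p q) r x = pd (christoffel g i q p) r x :=
    fun p q r => pd_congr hg.isOpen (fun x hx => hg.christoffel_symm hx i p q) hx r
  simp only [riem, hg.christoffel_symm hx _ k j, hg.christoffel_symm hx _ l j,
    hg.christoffel_symm hx _ l k, h k j, h l j, h l k]
  ring

lemma second_bianchi (hg : IsSmoothMetricOn U g) (hx : x ∈ U) (i j k l m : Fin n) :
    (pd (riem g i j k l) m x + ∑ p, christoffel g i m p x * riem g p j k l x
        - ∑ p, riem g i p k l x * christoffel g p m j x)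
      + (pd (riem g i j l m) k x + ∑ p, christoffel g i k p x * riem g p j l m x
        - ∑ p, riem g i p l m x * christoffel g p k j x)
      + (pd (riem g i j m k) l x + ∑ p, christoffel g i l p x * riem g p j m k x
        - ∑ p, riem g i p m k x * christoffel g p l j x) = 0 := by
  let A : Fin n → Matrix (Fin n) (Fin n) ℝ := fun k => .of fun i j => christoffel g i k j x
  let dA : Fin n → Fin n → Matrix (Fin n) (Fin n) ℝ :=
    fun m k => .of fun i j => pd (christoffel g i k j) m x
  let ddA : Fin n → Fin n → Fin n → Matrix (Fin n) (Fin n) ℝ :=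
    fun m k l => .of fun i j => pd (pd (christoffel g i l j) k) m x
  have hd := hg.differentiableAt_christoffel hx
  have hdd : ∀ i k j l, DifferentiableAt ℝ (pd (christoffel g i k j) l) x := fun i k j l =>
    (contDiffOn_pd hg.isOpen (hg.contDiffOn_christoffel i k j) l).differentiableAt_of_isOpen
      hg.isOpen hx
  have hsymm : ∀ m k l, ddA m k l = ddA k m l := fun m k l => by
    ext i j
    exact pd_comm hg.isOpen (hg.contDiffOn_christoffel i l j) hx k m
  have hR : ∀ i j k l, riem g i j k l x = (dA k l - dA l k + A k * A l - A l * A k) i j := by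
    intro i j k l
    simp [riem, A, dA, Matrix.mul_apply]
  have hdR : ∀ i j k l m, pd (riem g i j k l) m x
      = (ddA m k l - ddA m l k + (dA m k * A l + A k * dA m l)
        - (dA m l * A k + A l * dA m k)) i j := by
    intro i j k l m
    change pd (fun x => pd (christoffel g i l j) k x - pd (christoffel g i k j) l x
      + ∑ m, christoffel g i k m x * christoffel g m l j x
      - ∑ m, christoffel g i l m x * christoffel g m k j x) m x = _
    have hprod : ∀ k l, pd (fun x => ∑ p, christoffel g i k p x * christoffel g p l j x) m x
        = (dA m k * A l + A k * dA m l) i j := by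
      intro k l
      rw [pd_sum (by fun_prop)]
      simp only [pd_mul (hd _ _ _) (hd _ _ _), Matrix.add_apply, Matrix.mul_apply,
        Finset.sum_add_distrib, A, dA, Matrix.of_apply]
    rw [pd_sub (by fun_prop) (by fun_prop), pd_add (by fun_prop) (by fun_prop),
      pd_sub (hdd _ _ _ _) (hdd _ _ _ _), hprod, hprod]
    simp [ddA]
  have hA : ∀ k i p, christoffel g i k p x = A k i p := fun _ _ _ => rfl
  simp only [hR, hdR, hA, ← Matrix.mul_apply, ← Matrix.add_apply, ← Matrix.sub_apply]
  rw [hsymm m k l, hsymm m l k, hsymm k l m]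
  generalize ddA k m l = X1
  generalize ddA l m k = X2
  generalize ddA l k m = X3
  refine congrFun (congrFun (?_ : (_ : Matrix (Fin n) (Fin n) ℝ) = 0) i) j
  noncomm_ring

/-- **Schur's lemma**: in dimension at least three, a sectional curvature depending only on the
point has vanishing differential. -/
lemma pd_eq_zero_of_riem_eq (hg : IsSmoothMetricOn U g) (hn : 3 ≤ n) {μ : Vec n → ℝ}
    (hμ : ∀ x ∈ U, DifferentiableAt ℝ μ x)
    (hR : ∀ x ∈ U, ∀ i j k l, riem g i j k l x
      = μ x * ((if i = k then 1 else 0) * g x l j - (if i = l then 1 else 0) * g x k j))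
    (hx : x ∈ U) (m : Fin n) : pd μ m x = 0 := by
  have hdg : ∀ i j, DifferentiableAt ℝ (fun x => g x i j) x := fun i j =>
    (hg.smooth i j).differentiableAt_of_isOpen hg.isOpen hx
  have hdμ := hμ x hx
  have hdR : ∀ i j k l m, pd (riem g i j k l) m x
      = pd μ m x * ((if i = k then 1 else 0) * g x l j - (if i = l then 1 else 0) * g x k j)
        + μ x * ((if i = k then 1 else 0) * pd (fun x => g x l j) m x
          - (if i = l then 1 else 0) * pd (fun x => g x k j) m x) := by
    intro i j k l m
    rw [pd_congr hg.isOpen (fun x hx => hR x hx i j k l) hx, pd_mul hdμ (by fun_prop),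
      pd_sub (by fun_prop) (by fun_prop), pd_const_mul (by fun_prop), pd_const_mul (by fun_prop)]
  have hleft : ∀ i j k l m, ∑ p, christoffel g i m p x * riem g p j k l x
      = μ x * (christoffel g i m k x * g x l j - christoffel g i m l x * g x k j) := by
    intro i j k l m
    simp only [hR x hx, mul_sub, Finset.sum_sub_distrib]
    simp
    ring
  have hright : ∀ i j k l m, ∑ p, riem g i p k l x * christoffel g p m j x
      = μ x * ((if i = k then 1 else 0) * ∑ p, g x l p * christoffel g p j m x
        - (if i = l then 1 else 0) * ∑ p, g x k p * christoffel g p j m x) := by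
    intro i j k l m
    simp only [hR x hx, mul_sub, sub_mul, Finset.sum_sub_distrib, Finset.mul_sum,
      hg.christoffel_symm hx _ m j, mul_assoc]
  have hcyc : ∀ i j k l m,
      pd μ m x * ((if i = k then 1 else 0) * g x l j - (if i = l then 1 else 0) * g x k j)
      + pd μ k x * ((if i = l then 1 else 0) * g x m j - (if i = m then 1 else 0) * g x l j)
      + pd μ l x * ((if i = m then 1 else 0) * g x k j - (if i = k then 1 else 0) * g x m j)
      = 0 := by
    intro i j k l m
    have h := hg.second_bianchi hx i j k l m
    have hs : ∀ p q r, ∑ s, g x p s * christoffel g s q r x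
        = ∑ s, g x p s * christoffel g s r q x := fun p q r =>
      Finset.sum_congr rfl fun s _ => by rw [hg.christoffel_symm hx]
    simp only [hdR, hleft, hright, hg.pd_metric hx] at h
    rw [hs j l m, hs j k m, hs j l k, hg.christoffel_symm hx i l k, hg.christoffel_symm hx i m l,
      hg.christoffel_symm hx i m k] at h
    linear_combination h
  have htrace : ∀ j l, pd μ m x * g x l j = pd μ l x * g x m j := by
    intro j l
    have h : ∑ i, (pd μ m x * ((if i = i then 1 else 0) * g x l j
          - (if i = l then 1 else 0) * g x i j)
        + pd μ i x * ((if i = l then 1 else 0) * g x m j - (if i = m then 1 else 0) * g x l j)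
        + pd μ l x * ((if i = m then 1 else 0) * g x i j - (if i = i then 1 else 0) * g x m j))
        = 0 :=
      Finset.sum_eq_zero fun i _ => hcyc i j i l m
    simp only [Finset.sum_add_distrib, mul_sub, Finset.sum_sub_distrib] at h
    simp at h
    have hn' : (n : ℝ) - 2 ≠ 0 := by
      have : (3 : ℝ) ≤ n := by exact_mod_cast hn
      linarith
    refine mul_left_cancel₀ hn' ?_
    linear_combination h
  have : Nontrivial (Fin n) := Fin.nontrivial_iff_two_le.mpr (by omega)
  obtain ⟨l, hl⟩ := exists_ne m
  have h1 : ∑ j, pd μ m x * g x l j * (g x)⁻¹ j l = ∑ j, pd μ l x * g x m j * (g x)⁻¹ j l :=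
    Finset.sum_congr rfl fun j _ => by rw [htrace]
  simp only [mul_assoc, ← Finset.mul_sum, hg.sum_mul_inv hx] at h1
  simpa [hl.symm] using h1

lemma pd_raise (hg : IsSmoothMetricOn U g)
    (hb : ∀ i, ContDiffOn ℝ (⊤ : ℕ∞) (fun x => b x i) U) (hx : x ∈ U) (i j : Fin n) :
    pd (raise g b i) j x = ∑ k, (g x)⁻¹ i k * covDeriv g b k j x
      - ∑ m, christoffel g i j m x * raise g b m x := by
  have hdB : ∀ i, DifferentiableAt ℝ (raise g b i) x := fun i =>
    (hg.contDiffOn_raise hb i).differentiableAt_of_isOpen hg.isOpen hx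
  have hdg : ∀ i j, DifferentiableAt ℝ (fun x => g x i j) x := fun i j =>
    (hg.smooth i j).differentiableAt_of_isOpen hg.isOpen hx
  have hlower : ∀ x ∈ U, ∀ k, ∑ p, g x k p * raise g b p x = b x k := fun x hx k =>
    hg.sum_mul_sum_inv_mul hx (b x) k
  have hpd : ∀ k, ∑ p, g x k p * pd (raise g b p) j x
      = covDeriv g b k j x - ∑ p, g x k p * ∑ m, christoffel g p j m x * raise g b m x := by
    intro k
    have h := pd_congr hg.isOpen (fun x hx => hlower x hx k) hx j
    rw [pd_sum (by fun_prop)] at h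
    simp only [pd_mul (hdg _ _) (hdB _), Finset.sum_add_distrib, hg.pd_metric hx, add_mul] at h
    have h1 : ∑ p, (∑ m, g x k m * christoffel g m p j x) * raise g b p x
        = ∑ p, g x k p * ∑ m, christoffel g p j m x * raise g b m x := by
      simp only [Finset.sum_mul, Finset.mul_sum]
      rw [Finset.sum_comm]
      refine Finset.sum_congr rfl fun p _ => Finset.sum_congr rfl fun m _ => ?_
      rw [hg.christoffel_symm hx p m j]
      ring
    have h2 : ∑ p, (∑ m, g x p m * christoffel g m k j x) * raise g b p x
        = ∑ m, b x m * christoffel g m k j x := by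
      simp only [← hlower x hx, Finset.sum_mul]
      rw [Finset.sum_comm]
      refine Finset.sum_congr rfl fun p _ => Finset.sum_congr rfl fun m _ => ?_
      rw [hg.symm x hx m p]
      ring
    rw [h1, h2] at h
    rw [covDeriv]
    linear_combination h
  rw [← hg.sum_inv_mul_sum_mul hx (fun p => pd (raise g b p) j x) i]
  simp only [hpd, mul_sub, Finset.sum_sub_distrib]
  rw [hg.sum_inv_mul_sum_mul hx (fun p => ∑ m, christoffel g p j m x * raise g b m x) i]

end IsSmoothMetricOn

lemma add_swap_eq_zero_of_quadraticForm_eq_zero {ι : Type*} [Fintype ι] [DecidableEq ι]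
    {S : ι → ι → ℝ} (h : ∀ y : ι → ℝ, ∑ j, ∑ l, S j l * y j * y l = 0) (j l : ι) :
    S j l + S l j = 0 := by
  have h1 := h (Pi.single j 1)
  have h2 := h (Pi.single l 1)
  have h3 := h (Pi.single j 1 + Pi.single l 1)
  simp [Pi.single_apply, mul_add, Finset.sum_add_distrib] at h1 h2 h3
  linarith

/-- An algebraic curvature tensor is determined by its sectional quadratic forms. -/
lemma curvature_ext {ι : Type*} [Fintype ι] [DecidableEq ι] {R T : ι → ι → ι → ℝ}
    (hR : ∀ j k l, R j l k = - R j k l) (hR' : ∀ j k l, R j k l + R k l j + R l j k = 0)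
    (hT : ∀ j k l, T j l k = - T j k l) (hT' : ∀ j k l, T j k l + T k l j + T l j k = 0)
    (h : ∀ k (y : ι → ℝ), ∑ j, ∑ l, R j k l * y j * y l = ∑ j, ∑ l, T j k l * y j * y l)
    (j k l : ι) : R j k l = T j k l := by
  have hpol : ∀ j k l, R j k l - T j k l + (R l k j - T l k j) = 0 := fun j k l =>
    add_swap_eq_zero_of_quadraticForm_eq_zero (S := fun j l => R j k l - T j k l)
      (fun y => by simp only [sub_mul, Finset.sum_sub_distrib, h, sub_self]) j l
  linarith [hpol j k l, hpol k l j, hR' j k l, hT' j k l, hR k l j, hT k l j, hR l k j, hT l k j,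
    hR j k l, hT j k l]

/-- A Riemannian metric and a 1-form of length less than one satisfying (E1)–(E3). -/
structure IsSquareData {n : ℕ} (U : Set (Vec n)) (a : Vec n → Matrix (Fin n) (Fin n) ℝ)
    (b : Vec n → Vec n) (τ lam : Vec n → ℝ) : Prop where
  metric : IsSmoothMetricOn U a
  posDef : ∀ x ∈ U, (a x).PosDef
  smooth_form : ∀ i, ContDiffOn ℝ (⊤ : ℕ∞) (fun x => b x i) U
  bsq_lt_one : ∀ x ∈ U, bsq a b x < 1
  smooth_tau : ContDiffOn ℝ (⊤ : ℕ∞) τ U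
  smooth_lam : ContDiffOn ℝ (⊤ : ℕ∞) lam U
  eqs : E123 U a b τ lam

namespace IsSquareData

variable {n : ℕ} {U : Set (Vec n)} {a : Vec n → Matrix (Fin n) (Fin n) ℝ} {b : Vec n → Vec n}
  {τ lam : Vec n → ℝ} {x : Vec n}

lemma bsq_eq (x : Vec n) : bsq a b x = ∑ i, raise a b i x * b x i := by
  simp only [bsq, raise, Finset.sum_mul]
  refine Finset.sum_congr rfl fun i _ => Finset.sum_congr rfl fun j _ => ?_
  ring

lemma sum_mul_raise (h : IsSquareData U a b τ lam) (hx : x ∈ U) (i : Fin n) :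
    ∑ j, a x i j * raise a b j x = b x i :=
  h.metric.sum_mul_sum_inv_mul hx (b x) i

lemma differentiableAt_metric (h : IsSquareData U a b τ lam) (hx : x ∈ U) (i j : Fin n) :
    DifferentiableAt ℝ (fun x => a x i j) x :=
  (h.metric.smooth i j).differentiableAt_of_isOpen h.metric.isOpen hx

lemma differentiableAt_form (h : IsSquareData U a b τ lam) (hx : x ∈ U) (i : Fin n) :
    DifferentiableAt ℝ (fun x => b x i) x :=
  (h.smooth_form i).differentiableAt_of_isOpen h.metric.isOpen hx

lemma differentiableAt_raise (h : IsSquareData U a b τ lam) (hx : x ∈ U) (i : Fin n) :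
    DifferentiableAt ℝ (raise a b i) x :=
  (h.metric.contDiffOn_raise h.smooth_form i).differentiableAt_of_isOpen h.metric.isOpen hx

lemma differentiableAt_tau (h : IsSquareData U a b τ lam) (hx : x ∈ U) :
    DifferentiableAt ℝ τ x :=
  h.smooth_tau.differentiableAt_of_isOpen h.metric.isOpen hx

lemma contDiffOn_bsq (h : IsSquareData U a b τ lam) :
    ContDiffOn ℝ (⊤ : ℕ∞) (bsq a b) U :=
  ContDiffOn.sum fun i _ => ContDiffOn.sum fun j _ =>
    ((h.metric.contDiffOn_inv i j).mul (h.smooth_form i)).mul (h.smooth_form j)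

lemma differentiableAt_bsq (h : IsSquareData U a b τ lam) (hx : x ∈ U) :
    DifferentiableAt ℝ (bsq a b) x :=
  h.contDiffOn_bsq.differentiableAt_of_isOpen h.metric.isOpen hx

lemma pd_form (h : IsSquareData U a b τ lam) (hx : x ∈ U) (i j : Fin n) :
    pd (fun x => b x i) j x = τ x * ((1 + 2 * bsq a b x) * a x i j - 3 * b x i * b x j)
      + ∑ k, b x k * christoffel a k i j x := by
  rw [← h.eqs.1 x hx, covDeriv]
  ring

lemma pd_raise (h : IsSquareData U a b τ lam) (hx : x ∈ U) (i j : Fin n) :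
    pd (raise a b i) j x = τ x * ((1 + 2 * bsq a b x) * (if i = j then 1 else 0)
        - 3 * raise a b i x * b x j)
      - ∑ m, christoffel a i j m x * raise a b m x := by
  rw [h.metric.pd_raise h.smooth_form hx]
  congr 1
  rw [← h.metric.sum_inv_mul hx, raise]
  simp only [h.eqs.1 x hx, Finset.mul_sum, mul_sub, Finset.sum_mul, ← Finset.sum_sub_distrib]
  refine Finset.sum_congr rfl fun k _ => ?_
  ring

lemma pd_bsq (h : IsSquareData U a b τ lam) (hx : x ∈ U) (j : Fin n) :
    pd (bsq a b) j x = 2 * τ x * (1 - bsq a b x) * b x j := by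
  have hdb := h.differentiableAt_form hx
  have hdB := h.differentiableAt_raise hx
  have hfun : bsq a b = fun x => ∑ i, raise a b i x * b x i := funext bsq_eq
  have hcancel : ∑ i, (∑ m, christoffel a i j m x * raise a b m x) * b x i
      = ∑ i, raise a b i x * ∑ k, b x k * christoffel a k i j x := by
    simp only [Finset.sum_mul, Finset.mul_sum]
    rw [Finset.sum_comm]
    refine Finset.sum_congr rfl fun i _ => Finset.sum_congr rfl fun m _ => ?_
    rw [h.metric.christoffel_symm hx m j i]
    ring
  have hlow : ∑ i, raise a b i x * a x i j = b x j := by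
    rw [← h.sum_mul_raise hx j]
    exact Finset.sum_congr rfl fun i _ => by rw [h.metric.symm x hx i j, mul_comm]
  have h1 : ∑ i, τ x * ((1 + 2 * bsq a b x) * (if i = j then 1 else 0)
      - 3 * raise a b i x * b x j) * b x i
      = τ x * ((1 + 2 * bsq a b x) * b x j - 3 * bsq a b x * b x j) := by
    have : ∀ i, τ x * ((1 + 2 * bsq a b x) * (if i = j then 1 else 0)
        - 3 * raise a b i x * b x j) * b x i
        = τ x * (1 + 2 * bsq a b x) * (if i = j then b x i else 0)
          - 3 * τ x * b x j * (raise a b i x * b x i) := by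
      intro i
      split_ifs <;> ring
    simp only [this, Finset.sum_sub_distrib, ← Finset.mul_sum, ← bsq_eq]
    simp
    ring
  have h2 : ∑ i, raise a b i x * (τ x * ((1 + 2 * bsq a b x) * a x i j - 3 * b x i * b x j))
      = τ x * ((1 + 2 * bsq a b x) * b x j - 3 * bsq a b x * b x j) := by
    have : ∀ i, raise a b i x * (τ x * ((1 + 2 * bsq a b x) * a x i j - 3 * b x i * b x j))
        = τ x * (1 + 2 * bsq a b x) * (raise a b i x * a x i j)
          - 3 * τ x * b x j * (raise a b i x * b x i) := fun i => by ring
    simp only [this, Finset.sum_sub_distrib, ← Finset.mul_sum, ← bsq_eq, hlow]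
    ring
  conv_lhs => rw [hfun]
  rw [pd_sum (by fun_prop)]
  simp only [pd_mul (hdB _) (hdb _), h.pd_raise hx, h.pd_form hx, sub_mul, mul_add,
    Finset.sum_add_distrib, Finset.sum_sub_distrib, h1, h2, hcancel]
  ring

lemma isSmoothMetricOn_hOf (h : IsSquareData U a b τ lam) : IsSmoothMetricOn U (hOf a b) where
  isOpen := h.metric.isOpen
  smooth i j := ((contDiffOn_const.sub h.contDiffOn_bsq).pow 2).mul (h.metric.smooth i j)
  symm x hx i j := by simp [hOf, h.metric.symm x hx i j]
  isUnit_det x hx := by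
    have hs : hOf a b x = (1 - bsq a b x) ^ 2 • a x := rfl
    have h1 : 1 - bsq a b x ≠ 0 := by linarith [h.bsq_lt_one x hx]
    rw [hs, Matrix.det_smul]
    exact (isUnit_iff_ne_zero.mpr (pow_ne_zero _ (pow_ne_zero _ h1))).mul
      (h.metric.isUnit_det x hx)

lemma inv_hOf (h : IsSquareData U a b τ lam) (hx : x ∈ U) (i j : Fin n) :
    (hOf a b x)⁻¹ i j = ((1 - bsq a b x) ^ 2)⁻¹ * (a x)⁻¹ i j := by
  have h1 : (1 - bsq a b x) ^ 2 ≠ 0 := pow_ne_zero _ (by linarith [h.bsq_lt_one x hx])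
  have hinv : (hOf a b x)⁻¹ = ((1 - bsq a b x) ^ 2)⁻¹ • (a x)⁻¹ := by
    have hs : hOf a b x = (1 - bsq a b x) ^ 2 • a x := rfl
    refine Matrix.inv_eq_right_inv ?_
    rw [hs, Matrix.smul_mul, Matrix.mul_smul, smul_smul, mul_inv_cancel₀ h1, one_smul,
      Matrix.mul_nonsing_inv _ (h.metric.isUnit_det x hx)]
  rw [hinv]
  rfl

lemma pd_hOf (h : IsSquareData U a b τ lam) (hx : x ∈ U) (i j k : Fin n) :
    pd (fun x => hOf a b x i j) k x
      = (1 - bsq a b x) ^ 2 * (pd (fun x => a x i j) k x - 4 * τ x * b x k * a x i j) := by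
  have hdq := h.differentiableAt_bsq hx
  have hda := h.differentiableAt_metric hx
  change pd (fun x => (1 - bsq a b x) ^ 2 * a x i j) k x = _
  rw [pd_mul (by fun_prop) (hda i j)]
  simp only [sq]
  rw [pd_mul (by fun_prop) (by fun_prop), pd_sub (by fun_prop) hdq, pd_const,
    h.pd_bsq hx]
  ring

lemma christoffel_hOf (h : IsSquareData U a b τ lam) (hx : x ∈ U) (i j k : Fin n) :
    christoffel (hOf a b) i j k x = christoffel a i j k x
      - 2 * (τ x * ((if i = j then 1 else 0) * b x k + (if i = k then 1 else 0) * b x j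
        - a x j k * raise a b i x)) := by
  have h1 : 1 - bsq a b x ≠ 0 := by linarith [h.bsq_lt_one x hx]
  rw [← h.metric.sum_inv_mul hx i j, ← h.metric.sum_inv_mul hx i k]
  simp only [christoffel, raise, h.inv_hOf hx, h.pd_hOf hx, Finset.mul_sum, Finset.sum_mul,
    ← Finset.sum_add_distrib, ← Finset.sum_sub_distrib]
  refine Finset.sum_congr rfl fun l _ => ?_
  field_simp
  ring

lemma riem_metric (h : IsSquareData U a b τ lam) (hx : x ∈ U) (i j k l : Fin n) :
    riem a i j k l x
      = lam x * ((if i = k then 1 else 0) * a x l j - (if i = l then 1 else 0) * a x k j)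
        + 2 * (lam x + 4 * (2 + bsq a b x) * (τ x) ^ 2) *
          ((if i = k then 1 else 0) * b x j * b x l - (if i = l then 1 else 0) * b x j * b x k
            + b x k * raise a b i x * a x l j - b x l * raise a b i x * a x k j) := by
  refine curvature_ext (R := fun j k l => riem a i j k l x)
    (T := fun j k l =>
      lam x * ((if i = k then 1 else 0) * a x l j - (if i = l then 1 else 0) * a x k j)
        + 2 * (lam x + 4 * (2 + bsq a b x) * (τ x) ^ 2) *
          ((if i = k then 1 else 0) * b x j * b x l - (if i = l then 1 else 0) * b x j * b x k
            + b x k * raise a b i x * a x l j - b x l * raise a b i x * a x k j))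
    (fun j k l => IsSmoothMetricOn.riem_swap i j k l)
    (fun j k l => h.metric.riem_cyclic hx i j k l) (fun j k l => by ring)
    (fun j k l => by
      rw [h.metric.symm x hx l j, h.metric.symm x hx l k, h.metric.symm x hx k j]
      ring)
    (fun k y => ?_) j k l
  have hα : alphaOf a x y ^ 2 = ∑ j, ∑ l, a x l j * y j * y l := by
    have hq : ∑ i, ∑ j, a x i j * y i * y j = y ⬝ᵥ (a x).mulVec y := by
      simp only [dotProduct, Matrix.mulVec, Finset.mul_sum]
      exact Finset.sum_congr rfl fun i _ => Finset.sum_congr rfl fun j _ => by ring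
    rw [alphaOf, Real.sq_sqrt]
    · exact Finset.sum_congr rfl fun i _ => Finset.sum_congr rfl fun j _ => by
        rw [h.metric.symm x hx i j]
    · rw [hq]
      simpa using (h.posDef x hx).posSemidef.dotProduct_mulVec_nonneg y
  have hβ : betaOf b x y * betaOf b x y = ∑ j, ∑ l, b x j * b x l * y j * y l := by
    rw [betaOf, Finset.sum_mul_sum]
    exact Finset.sum_congr rfl fun i _ => Finset.sum_congr rfl fun j _ => by ring
  have hβy : betaOf b x y * y i
      = ∑ j, ∑ l, (if i = l then 1 else 0) * b x j * y j * y l := by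
    rw [betaOf, Finset.sum_mul]
    refine Finset.sum_congr rfl fun j _ => ?_
    simp
  have hay : (∑ j, a x k j * y j) * y i
      = ∑ j, ∑ l, (if i = l then 1 else 0) * a x k j * y j * y l := by
    rw [Finset.sum_mul]
    refine Finset.sum_congr rfl fun j _ => ?_
    simp
  have hβa : (∑ j, a x k j * y j) * betaOf b x y
      = ∑ j, ∑ l, a x k j * b x l * y j * y l := by
    rw [betaOf, Finset.sum_mul_sum]
    exact Finset.sum_congr rfl fun i _ => Finset.sum_congr rfl fun j _ => by ring
  change ∑ j, ∑ l, riem a i j k l x * y j * y l = _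
  rw [← h.metric.curvOfSpray_sprayOf hx, h.eqs.2.1 x hx y i k]
  have hB : ∑ j, (a x)⁻¹ i j * b x j = raise a b i x := rfl
  rw [hB]
  trans lam x * ((if i = k then 1 else 0) * (alphaOf a x y ^ 2)
      - (∑ j, a x k j * y j) * y i)
    + 2 * (lam x + 4 * (2 + bsq a b x) * (τ x) ^ 2) *
      ((if i = k then 1 else 0) * (betaOf b x y * betaOf b x y)
        - b x k * (betaOf b x y * y i)
        + b x k * raise a b i x * (alphaOf a x y ^ 2)
        - raise a b i x * ((∑ j, a x k j * y j) * betaOf b x y))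
  · ring
  · rw [hα, hβ, hβy, hay, hβa]
    simp only [Finset.mul_sum, ← Finset.sum_add_distrib, ← Finset.sum_sub_distrib]
    refine Finset.sum_congr rfl fun j _ => Finset.sum_congr rfl fun l _ => ?_
    ring

lemma pd_christoffel_hOf (h : IsSquareData U a b τ lam) (hx : x ∈ U) (i j k l : Fin n) :
    pd (christoffel (hOf a b) i j k) l x = pd (christoffel a i j k) l x
      - 2 * (pd τ l x * ((if i = j then 1 else 0) * b x k + (if i = k then 1 else 0) * b x j
          - a x j k * raise a b i x)
        + τ x * ((if i = j then 1 else 0) * pd (fun x => b x k) l x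
          + (if i = k then 1 else 0) * pd (fun x => b x j) l x
          - (pd (fun x => a x j k) l x * raise a b i x
            + a x j k * pd (raise a b i) l x))) := by
  have hdb := h.differentiableAt_form hx
  have hdB := h.differentiableAt_raise hx
  have hda := h.differentiableAt_metric hx
  have hdτ := h.differentiableAt_tau hx
  have hdΓ := h.metric.differentiableAt_christoffel hx
  rw [pd_congr h.metric.isOpen (fun x hx => h.christoffel_hOf hx i j k) hx,
    pd_sub (hdΓ _ _ _) (by fun_prop), pd_const_mul (by fun_prop), pd_mul hdτ (by fun_prop),
    pd_sub (by fun_prop) (by fun_prop), pd_add (by fun_prop) (by fun_prop),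
    pd_const_mul (hdb _), pd_const_mul (hdb _), pd_mul (hda _ _) (hdB _)]

lemma sum_christoffel_hOf_mul (h : IsSquareData U a b τ lam) (hx : x ∈ U) (i j k l : Fin n) :
    ∑ m, christoffel (hOf a b) i k m x * christoffel (hOf a b) m l j x
      = ∑ m, christoffel a i k m x * christoffel a m l j x
        - 2 * τ x * (christoffel a i k l x * b x j + christoffel a i k j x * b x l
          - a x l j * ∑ m, christoffel a i k m x * raise a b m x)
        - 2 * τ x * ((if i = k then 1 else 0) * ∑ m, b x m * christoffel a m l j x
          + b x k * christoffel a i l j x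
          - raise a b i x * ∑ m, a x k m * christoffel a m l j x)
        + 4 * (τ x) ^ 2 * ((if i = k then 1 else 0) * (2 * b x l * b x j - a x l j * bsq a b x)
          + b x k * ((if i = l then 1 else 0) * b x j + (if i = j then 1 else 0) * b x l
            - a x l j * raise a b i x)
          - raise a b i x * (a x k l * b x j + a x k j * b x l - a x l j * b x k)) := by
  have hexp : ∀ m, christoffel (hOf a b) i k m x * christoffel (hOf a b) m l j x
      = christoffel a i k m x * christoffel a m l j x
        - 2 * τ x * ((if m = l then christoffel a i k m x * b x j else 0)
          + (if m = j then christoffel a i k m x * b x l else 0)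
          - a x l j * (christoffel a i k m x * raise a b m x))
        - 2 * τ x * ((if i = k then 1 else 0) * (b x m * christoffel a m l j x)
          + (if i = m then b x k * christoffel a m l j x else 0)
          - raise a b i x * (a x k m * christoffel a m l j x))
        + 4 * (τ x) ^ 2 * ((if i = k then 1 else 0) * ((if m = l then b x m * b x j else 0)
            + (if m = j then b x m * b x l else 0) - a x l j * (raise a b m x * b x m))
          + (if i = m then b x k * ((if m = l then 1 else 0) * b x j
            + (if m = j then 1 else 0) * b x l - a x l j * raise a b m x) else 0)
          - raise a b i x * ((if m = l then a x k m * b x j else 0)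
            + (if m = j then a x k m * b x l else 0) - a x l j * (a x k m * raise a b m x))) := by
    intro m
    rw [h.christoffel_hOf hx, h.christoffel_hOf hx]
    split_ifs <;> ring
  simp only [hexp, Finset.sum_add_distrib, Finset.sum_sub_distrib, ← Finset.mul_sum, ← bsq_eq,
    h.sum_mul_raise hx, Finset.sum_ite_eq, Finset.sum_ite_eq', Finset.mem_univ, if_true]
  ring

lemma riem_hOf (h : IsSquareData U a b τ lam) (hx : x ∈ U) (i j k l : Fin n) :
    riem (hOf a b) i j k l x = (lam x + 4 * (1 + bsq a b x) * (τ x) ^ 2) *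
      ((if i = k then 1 else 0) * a x l j - (if i = l then 1 else 0) * a x k j) := by
  have hΓ := h.metric.christoffel_symm hx
  have hs : ∀ p q r, ∑ s, a x p s * christoffel a s q r x
      = ∑ s, a x p s * christoffel a s r q x := fun p q r =>
    Finset.sum_congr rfl fun s _ => by rw [hΓ]
  have hb : ∀ q r, ∑ s, b x s * christoffel a s q r x
      = ∑ s, b x s * christoffel a s r q x := fun q r =>
    Finset.sum_congr rfl fun s _ => by rw [hΓ]
  have hR := h.riem_metric hx i j k l
  rw [riem] at hR ⊢
  simp only [h.pd_christoffel_hOf hx, h.sum_christoffel_hOf_mul hx, h.pd_form hx, h.pd_raise hx,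
    h.metric.pd_metric hx, h.eqs.2.2 x hx]
  rw [hs k l j, hs l k j, hs l j k, hs k j l, hs j l k, hb l k, hb j k, hb j l, hΓ i l k,
    h.metric.symm x hx k l, h.metric.symm x hx j l, h.metric.symm x hx j k]
  linear_combination hR

/-- The sectional curvature of the deformed metric. -/
def curv {n : ℕ} (a : Vec n → Matrix (Fin n) (Fin n) ℝ) (b : Vec n → Vec n) (τ lam : Vec n → ℝ)
    (x : Vec n) : ℝ :=
  (lam x + 4 * (1 + bsq a b x) * (τ x * τ x)) / ((1 - bsq a b x) * (1 - bsq a b x))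

lemma contDiffOn_curv (h : IsSquareData U a b τ lam) :
    ContDiffOn ℝ (⊤ : ℕ∞) (curv a b τ lam) U := by
  have hq := h.contDiffOn_bsq
  have hs := (contDiffOn_const (c := (1 : ℝ))).sub hq
  exact (h.smooth_lam.add ((contDiffOn_const.mul (contDiffOn_const.add hq)).mul
    (h.smooth_tau.mul h.smooth_tau))).div (hs.mul hs) fun x hx => by
      have h1 : 1 - bsq a b x ≠ 0 := by linarith [h.bsq_lt_one x hx]
      exact mul_ne_zero h1 h1

lemma curv_mul (h : IsSquareData U a b τ lam) (hx : x ∈ U) :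
    curv a b τ lam x * (1 - bsq a b x) ^ 2 = lam x + 4 * (1 + bsq a b x) * (τ x) ^ 2 := by
  have h1 : 1 - bsq a b x ≠ 0 := by linarith [h.bsq_lt_one x hx]
  rw [curv]
  field_simp

lemma riem_hOf_eq_curv (h : IsSquareData U a b τ lam) (hx : x ∈ U) (i j k l : Fin n) :
    riem (hOf a b) i j k l x = curv a b τ lam x *
      ((if i = k then 1 else 0) * hOf a b x l j - (if i = l then 1 else 0) * hOf a b x k j) := by
  rw [h.riem_hOf hx, ← h.curv_mul hx]
  simp only [hOf, Matrix.of_apply]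
  ring

lemma fderiv_curv (h : IsSquareData U a b τ lam) (hn : 3 ≤ n) (hx : x ∈ U) :
    fderiv ℝ (curv a b τ lam) x = 0 := by
  have hp : ∀ m, fderiv ℝ (curv a b τ lam) x (Pi.single m 1) = 0 := fun m =>
    h.isSmoothMetricOn_hOf.pd_eq_zero_of_riem_eq hn
      (fun x hx => h.contDiffOn_curv.differentiableAt_of_isOpen h.metric.isOpen hx)
      (fun x hx => h.riem_hOf_eq_curv hx) hx m
  ext v
  rw [pi_eq_sum_univ' v]
  simp [hp]

lemma curvOfSpray_hOf (h : IsSquareData U a b τ lam) (hx : x ∈ U) (i k : Fin n) (y : Vec n) :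
    curvOfSpray (sprayOf (hOf a b)) i k x y = curv a b τ lam x *
      ((∑ i', ∑ j', hOf a b x i' j' * y i' * y j') * (if i = k then 1 else 0)
        - y i * ∑ j, hOf a b x k j * y j) := by
  have h1 : y i * ∑ j, hOf a b x k j * y j
      = ∑ j, ∑ l, (if i = l then 1 else 0) * hOf a b x k j * y j * y l := by
    rw [Finset.mul_sum]
    refine Finset.sum_congr rfl fun j _ => ?_
    simp
    ring
  rw [h.isSmoothMetricOn_hOf.curvOfSpray_sprayOf hx, h1]
  simp only [Finset.mul_sum, Finset.sum_mul, ← Finset.sum_sub_distrib]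
  refine Finset.sum_congr rfl fun j _ => Finset.sum_congr rfl fun l _ => ?_
  rw [h.riem_hOf_eq_curv hx, h.isSmoothMetricOn_hOf.symm x hx l j]
  ring

lemma pd_wOf (h : IsSquareData U a b τ lam) (hx : x ∈ U) (i j : Fin n) :
    pd (fun x => wOf a b x i) j x
      = √(1 - bsq a b x) * (pd (fun x => b x i) j x - τ x * b x i * b x j) := by
  have hs : 0 < 1 - bsq a b x := by linarith [h.bsq_lt_one x hx]
  have hd : DifferentiableAt ℝ (fun x => 1 - bsq a b x) x :=
    (differentiableAt_const _).sub (h.differentiableAt_bsq hx)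
  have hsqrt : pd (fun x => √(1 - bsq a b x)) j x = - τ x * √(1 - bsq a b x) * b x j := by
    have h1 := pd_sub (differentiableAt_const (1 : ℝ)) (h.differentiableAt_bsq hx) j
    rw [h.pd_bsq hx, pd_const] at h1
    rw [pd, fderiv_sqrt hd hs.ne']
    change 1 / (2 * √(1 - bsq a b x)) * pd (fun x => 1 - bsq a b x) j x = _
    rw [h1]
    have h2 := Real.sqrt_pos.mpr hs
    have h3 := Real.sq_sqrt hs.le
    field_simp
    linear_combination 2 * τ x * b x j * h3
  change pd (fun x => √(1 - bsq a b x) * b x i) j x = _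
  rw [pd_mul (hd.sqrt hs.ne') (h.differentiableAt_form hx i), hsqrt]
  ring

lemma covDeriv_wOf (h : IsSquareData U a b τ lam) (hx : x ∈ U) (i j : Fin n) :
    covDeriv (hOf a b) (wOf a b) i j x
      = τ x / (1 - bsq a b x) ^ ((3 : ℝ) / 2) * hOf a b x i j := by
  have hs : 0 < 1 - bsq a b x := by linarith [h.bsq_lt_one x hx]
  have hpow : (1 - bsq a b x) ^ ((3 : ℝ) / 2) = (1 - bsq a b x) * √(1 - bsq a b x) := by
    rw [show (3 : ℝ) / 2 = 1 + 1 / 2 by norm_num, Real.rpow_add hs, Real.rpow_one,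
      Real.sqrt_eq_rpow]
  have hterm : ∀ k, wOf a b x k * christoffel (hOf a b) k i j x
      = √(1 - bsq a b x) * (b x k * christoffel a k i j x
        - 2 * τ x * ((if k = i then b x k * b x j else 0) + (if k = j then b x k * b x i else 0)
          - a x i j * (raise a b k x * b x k))) := by
    intro k
    rw [h.christoffel_hOf hx, wOf]
    split_ifs <;> ring
  have hsum : ∑ k, wOf a b x k * christoffel (hOf a b) k i j x
      = √(1 - bsq a b x) * (∑ k, b x k * christoffel a k i j x
        - 2 * τ x * (2 * b x i * b x j - a x i j * bsq a b x)) := by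
    simp only [hterm, ← Finset.mul_sum, Finset.sum_sub_distrib, Finset.sum_add_distrib, ← bsq_eq,
      Finset.sum_ite_eq', Finset.mem_univ, if_true]
    ring
  rw [covDeriv, h.pd_wOf hx, hsum, h.pd_form hx, hpow]
  simp only [hOf, Matrix.of_apply]
  have h2 := Real.sqrt_pos.mpr hs
  have h3 := Real.sq_sqrt hs.le
  field_simp
  rw [h3]
  ring

lemma pd_wOf_symm (h : IsSquareData U a b τ lam) (hx : x ∈ U) (i j : Fin n) :
    pd (fun x => wOf a b x i) j x = pd (fun x => wOf a b x j) i x := by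
  rw [h.pd_wOf hx, h.pd_wOf hx, h.pd_form hx, h.pd_form hx, h.metric.symm x hx i j]
  simp only [h.metric.christoffel_symm hx _ i j]
  ring

end IsSquareData

/-- Theorem 4.1 (key step): under (E1)–(E3), for `h_{ij} = (1−b²)²a_{ij}` and
`w_i = (1−b²)^{1/2}b_i`:
(i) `μ := (λ + 4(1+b²)τ²)/(1−b²)²` is constant and `h` has constant sectional
curvature `μ`, i.e. `R̃ⁱ_k = μ(h²δⁱ_k − yⁱỹ_k)`;
(ii) `w_{i|j} = τ(1−b²)^{−3/2} h_{ij}`; in particular `ω = w_iyⁱ` is closed and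
conformal with respect to `h`. -/
theorem stmt_7 {n : ℕ} (hn : 3 ≤ n) (U : Set (Vec n))
    (hU : IsOpen U) (hconn : IsConnected U)
    (a : Vec n → Matrix (Fin n) (Fin n) ℝ) (b : Vec n → Vec n)
    (ha : ∀ i j, ContDiffOn ℝ (⊤ : ℕ∞) (fun x => a x i j) U)
    (hsym : ∀ x ∈ U, (a x).IsSymm)
    (hpos : ∀ x ∈ U, (a x).PosDef)
    (hb : ∀ i, ContDiffOn ℝ (⊤ : ℕ∞) (fun x => b x i) U)
    (hb2 : ∀ x ∈ U, 0 < bsq a b x ∧ bsq a b x < 1)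
    (τ lam : Vec n → ℝ)
    (hτ : ContDiffOn ℝ (⊤ : ℕ∞) τ U) (hlam : ContDiffOn ℝ (⊤ : ℕ∞) lam U)
    (hE : E123 U a b τ lam) :
    ∃ μ : ℝ,
      (∀ x ∈ U, lam x = μ * (1 - bsq a b x)^2 - 4 * (1 + bsq a b x) * (τ x)^2) ∧
      (∀ x ∈ U, ∀ y : Vec n, ∀ i k : Fin n,
        curvOfSpray (sprayOf (hOf a b)) i k x y =
          μ * ((∑ i', ∑ j', hOf a b x i' j' * y i' * y j') * (if i = k then (1:ℝ) else 0)
            - y i * ∑ j, hOf a b x k j * y j)) ∧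
      (∀ x ∈ U, ∀ i j : Fin n,
        covDeriv (hOf a b) (wOf a b) i j x
          = τ x / (1 - bsq a b x) ^ ((3:ℝ)/2) * hOf a b x i j) ∧
      (∀ x ∈ U, ∀ i j : Fin n,
        pd (fun x => wOf a b x i) j x = pd (fun x => wOf a b x j) i x) := by
  have h : IsSquareData U a b τ lam :=
    { metric :=
        { isOpen := hU
          smooth := ha
          symm := fun x hx i j => (hsym x hx).apply j i
          isUnit_det := fun x hx => isUnit_iff_ne_zero.mpr (hpos x hx).det_pos.ne' }
      posDef := hpos
      smooth_form := hb
      bsq_lt_one := fun x hx => (hb2 x hx).2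
      smooth_tau := hτ
      smooth_lam := hlam
      eqs := hE }
  obtain ⟨μ, hμ⟩ := hU.exists_is_const_of_fderiv_eq_zero hconn.isPreconnected
    (fun x hx => (h.contDiffOn_curv.differentiableAt_of_isOpen hU hx).differentiableWithinAt)
    (fun x hx => h.fderiv_curv hn hx)
  refine ⟨μ, fun x hx => ?_, fun x hx y i k => ?_, fun x hx i j => h.covDeriv_wOf hx i j,
    fun x hx i j => h.pd_wOf_symm hx i j⟩
  · rw [← hμ x hx]
    linear_combination - h.curv_mul hx
  · rw [← hμ x hx]
    exact h.curvOfSpray_hOf hx i k y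
end
end
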